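/- arXiv:2106.00331 — 5 statements merged into one kernel-verified Lean document; each statement's English description precedes it below -/
import Mathlib

section
/- For every δ > 0 there exists a sequence (q_n) of positive real numbers with the following property: for every real Banach space X with a normalized monotone Schauder basis (e_n) and every decreasing sequence (r_n) of positive reals satisfying r_n/r_{n−1} ≤ q_n for all n ≥ 2, the set K = closed convex hull of ⋃_{k∈ℕ} r_k·B_{span(e_k)} (where B_{span(e_k)} = {t e_k : |t| ≤ 1}) is a (1+δ)-Lipschitz retract of X: there exists a map R : X → K with R(k) = k for all k ∈ K and ‖R(x) − R(y)‖ ≤ (1+δ)‖x − y‖ for all x, y ∈ X. -/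
open Filter Metric

section MonotoneBasis

variable {X : Type*} [NormedAddCommGroup X] [NormedSpace ℝ X]

/-- `e` is a normalized monotone Schauder basis with coordinate functionals `c`. -/
structure IsMonotoneBasis (e : ℕ → X) (c : ℕ → X →L[ℝ] ℝ) : Prop where
  norm_eq_one : ∀ n, ‖e n‖ = 1
  coord_apply : ∀ i j, c i (e j) = if i = j then 1 else 0
  tendsto : ∀ x, Tendsto (fun n => ∑ i ∈ Finset.range n, c i x • e i) atTop (nhds x)
  norm_sum_le : ∀ x n, ‖∑ i ∈ Finset.range n, c i x • e i‖ ≤ ‖x‖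
  abs_coord_le : ∀ x i, |c i x| ≤ 2 * ‖x‖

theorem exists_isMonotoneBasis (e : ℕ → X) (he : ∀ n, ‖e n‖ = 1)
    (hex : ∀ x : X, ∃! a : ℕ → ℝ,
      Tendsto (fun n => ∑ i ∈ Finset.range n, a i • e i) atTop (nhds x))
    (hmono : ∀ (x : X) (a : ℕ → ℝ),
      Tendsto (fun n => ∑ i ∈ Finset.range n, a i • e i) atTop (nhds x) →
      ∀ n, ‖∑ i ∈ Finset.range n, a i • e i‖ ≤ ‖x‖) :
    ∃ c : ℕ → X →L[ℝ] ℝ, IsMonotoneBasis e c := by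
  choose a ha huniq using hex
  simp only at ha huniq
  have hadd : ∀ x y, a (x + y) = a x + a y := fun x y => by
    refine (huniq _ _ ?_).symm
    simpa [add_smul, Finset.sum_add_distrib] using (ha x).add (ha y)
  have hsmul : ∀ (t : ℝ) x, a (t • x) = t • a x := fun t x => by
    refine (huniq _ _ ?_).symm
    simpa [mul_smul, Finset.smul_sum] using (ha x).const_smul t
  have hbound : ∀ x i, |a x i| ≤ 2 * ‖x‖ := fun x i => by
    have h : a x i • e i = ∑ j ∈ Finset.range (i + 1), a x j • e j -
        ∑ j ∈ Finset.range i, a x j • e j := by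
      rw [Finset.sum_range_succ]; abel
    have h1 := hmono x _ (ha x) (i + 1)
    have h2 := hmono x _ (ha x) i
    have h3 := norm_sub_le (∑ j ∈ Finset.range (i + 1), a x j • e j)
      (∑ j ∈ Finset.range i, a x j • e j)
    rw [← h, norm_smul, he, mul_one, Real.norm_eq_abs] at h3
    linarith
  let c : ℕ → X →L[ℝ] ℝ := fun i => LinearMap.mkContinuous
    { toFun := fun x => a x i
      map_add' := fun x y => by simp [hadd]
      map_smul' := fun t x => by simp [hsmul] } 2 (fun x => hbound x i)
  refine ⟨c, he, fun i j => ?_, ha, fun x n => hmono x _ (ha x) n, hbound⟩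
  have : (fun i => if i = j then (1 : ℝ) else 0) = a (e j) := by
    refine huniq _ _ ?_
    refine tendsto_const_nhds.congr' ?_
    filter_upwards [eventually_gt_atTop j] with n hn
    simp [ite_smul, hn]
  exact (congrFun this i).symm

/-- Weighted `ℓ¹`-norm of the first `n` coordinates. -/
noncomputable def coordGauge (c : ℕ → X →L[ℝ] ℝ) (r : ℕ → ℝ) (n : ℕ) (x : X) : ℝ :=
  ∑ i ∈ Finset.range n, |c i x| / r i

/-- The unit ball of the `ℓ¹`-norm of the coordinates, weighted by `1 / r`. -/
def gaugeBall (c : ℕ → X →L[ℝ] ℝ) (r : ℕ → ℝ) : Set X :=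
  {x | ∀ n, coordGauge c r n x ≤ 1}

variable {e : ℕ → X} {c : ℕ → X →L[ℝ] ℝ} {r : ℕ → ℝ}

theorem coordGauge_mono (hr : ∀ n, 0 < r n) (x : X) : Monotone fun n => coordGauge c r n x :=
  monotone_nat_of_le_succ fun n => by
    simp only [coordGauge, Finset.sum_range_succ]
    have := hr n
    have : 0 ≤ |c n x| / r n := by positivity
    linarith

theorem isClosed_gaugeBall : IsClosed (gaugeBall c r) := by
  simp only [gaugeBall, Set.ofPred_forall]
  refine isClosed_iInter fun n => isClosed_le ?_ continuous_const
  unfold coordGauge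
  fun_prop

theorem convex_gaugeBall (hr : ∀ n, 0 < r n) : Convex ℝ (gaugeBall c r) := by
  intro x hx y hy s t hs ht hst n
  have key : coordGauge c r n (s • x + t • y) ≤ s * coordGauge c r n x + t * coordGauge c r n y := by
    simp only [coordGauge, Finset.mul_sum, ← Finset.sum_add_distrib]
    refine Finset.sum_le_sum fun i _ => ?_
    have := hr i
    rw [← mul_div_assoc, ← mul_div_assoc, ← add_div]
    gcongr
    simp only [map_add, map_smul, smul_eq_mul]
    refine (abs_add_le _ _).trans ?_
    rw [abs_mul, abs_mul, abs_of_nonneg hs, abs_of_nonneg ht]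
  nlinarith [hx n, hy n]

theorem IsMonotoneBasis.coord_sum (h : IsMonotoneBasis e c) (a : ℕ → ℝ) (n j : ℕ) :
    c j (∑ i ∈ Finset.range n, a i • e i) = if j < n then a j else 0 := by
  simp [h.coord_apply]

theorem sum_smul_mem_convexHull (hr : ∀ n, 0 < r n) (n : ℕ) (a : ℕ → ℝ)
    (ha : ∑ i ∈ Finset.range n, |a i| / r i ≤ 1) :
    ∑ i ∈ Finset.range n, a i • e i ∈ convexHull ℝ
      (⋃ k : ℕ, {x : X | ∃ t : ℝ, x = t • e k ∧ |t| ≤ r k}) := by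
  set S := ⋃ k : ℕ, {x : X | ∃ t : ℝ, x = t • e k ∧ |t| ≤ r k}
  have hzero : (0 : X) ∈ convexHull ℝ S :=
    subset_convexHull ℝ S (Set.mem_iUnion.2 ⟨0, 0, by simp, by simpa using (hr 0).le⟩)
  let z : ℕ → X := fun i => (if 0 ≤ a i then r i else -r i) • e i
  have hz : ∀ i, z i ∈ convexHull ℝ S := fun i => by
    refine subset_convexHull ℝ S (Set.mem_iUnion.2 ⟨i, _, rfl, ?_⟩)
    split_ifs <;> simp [abs_of_pos (hr i)]
  have hnonneg : ∀ i ∈ Finset.range n, 0 ≤ |a i| / r i := fun i _ =>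
    div_nonneg (abs_nonneg _) (hr i).le
  have hsum : ∑ i ∈ Finset.range n, a i • e i =
      ∑ i ∈ Finset.range n, (|a i| / r i) • z i := by
    refine Finset.sum_congr rfl fun i _ => ?_
    have hri := (hr i).ne'
    simp only [z, smul_smul]
    congr 1
    split_ifs with ha0
    · rw [abs_of_nonneg ha0]; field_simp
    · rw [abs_of_neg (not_le.1 ha0)]; field_simp
  rw [hsum]
  rcases (Finset.sum_nonneg hnonneg).eq_or_lt with h0 | hpos
  · rw [Finset.sum_eq_zero fun i hi => by
      rw [(Finset.sum_eq_zero_iff_of_nonneg hnonneg).1 h0.symm i hi, zero_smul]]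
    exact hzero
  · have hcm := (convex_convexHull ℝ S).smul_mem_of_zero_mem hzero
      ((convex_convexHull ℝ S).centerMass_mem hnonneg hpos fun i _ => hz i) ⟨hpos.le, ha⟩
    rwa [Finset.centerMass, smul_smul, mul_inv_cancel₀ hpos.ne', one_smul] at hcm

theorem IsMonotoneBasis.closure_convexHull_eq (h : IsMonotoneBasis e c) (hr : ∀ n, 0 < r n) :
    closure (convexHull ℝ (⋃ k : ℕ, {x : X | ∃ t : ℝ, x = t • e k ∧ |t| ≤ r k})) =
      gaugeBall c r := by
  refine Set.Subset.antisymm ?_ fun x hx => ?_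
  · refine closure_minimal (convexHull_min ?_ (convex_gaugeBall hr)) isClosed_gaugeBall
    refine Set.iUnion_subset fun k => ?_
    rintro x ⟨t, rfl, ht⟩ n
    have : ∀ i ∈ Finset.range n, |c i (t • e k)| / r i = if i = k then |t| / r k else 0 := by
      intro i _
      by_cases hik : i = k
      · subst hik; simp [h.coord_apply]
      · simp [h.coord_apply, hik]
    rw [coordGauge, Finset.sum_congr rfl this, Finset.sum_ite_eq']
    split_ifs
    · rwa [div_le_one (hr k)]
    · exact zero_le_one
  · exact mem_closure_of_tendsto (h.tendsto x)
      (Eventually.of_forall fun n => sum_smul_mem_convexHull hr n _ (hx n))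

/-- Truncation of `t` to the interval `[-s, s]`. -/
noncomputable def clamp (s t : ℝ) : ℝ := max (-s) (min t s)

theorem clamp_eq_self {s t : ℝ} (h : |t| ≤ s) : clamp s t = t := by
  rw [abs_le] at h
  simp [clamp, h.1, h.2]

theorem abs_clamp_le {s t : ℝ} (hs : 0 ≤ s) : |clamp s t| ≤ s := by
  rw [abs_le, clamp]
  exact ⟨le_max_left _ _, max_le (by linarith) (min_le_right _ _)⟩

theorem exists_clamp_sub_eq {s : ℝ} (t t' : ℝ) :
    ∃ θ, 0 ≤ θ ∧ θ ≤ 1 ∧ clamp s t - clamp s t' = θ * (t - t') := by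
  wlog hle : t' ≤ t generalizing t t'
  · obtain ⟨θ, h0, h1, h2⟩ := this t' t (le_of_not_ge hle)
    exact ⟨θ, h0, h1, by linarith⟩
  have h0 : clamp s t' ≤ clamp s t := by unfold clamp; gcongr
  have h1 : clamp s t - clamp s t' ≤ t - t' := by unfold clamp; grind
  rcases hle.eq_or_lt with rfl | hlt
  · exact ⟨0, le_rfl, zero_le_one, by simp⟩
  · have hpos : 0 < t - t' := sub_pos.2 hlt
    refine ⟨(clamp s t - clamp s t') / (t - t'), div_nonneg (by linarith) hpos.le,
      (div_le_one hpos).2 h1, ?_⟩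
    field_simp

theorem abs_clamp_sub_clamp_le (s s' t : ℝ) : |clamp s t - clamp s' t| ≤ |s - s'| := by
  unfold clamp
  grind

/-- Keep the first `k` coordinates and truncate the `k`-th one so as to land in the ball
whenever the first `k` coordinates allow it. -/
noncomputable def clampCoord (e : ℕ → X) (c : ℕ → X →L[ℝ] ℝ) (r : ℕ → ℝ) (k : ℕ) (x : X) : X :=
  ∑ i ∈ Finset.range k, c i x • e i +
    clamp (r k * max 0 (1 - coordGauge c r k x)) (c k x) • e k

theorem IsMonotoneBasis.abs_coordGauge_sub_le (h : IsMonotoneBasis e c) (hr : ∀ n, 0 < r n)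
    {s : ℝ} {k : ℕ} (q : ℝ) (hs : ∀ i < k, s / r i ≤ q) (hs0 : 0 ≤ s) (x y : X) :
    s * |coordGauge c r k x - coordGauge c r k y| ≤ 2 * k * q * ‖x - y‖ := by
  rw [coordGauge, coordGauge, ← Finset.sum_sub_distrib]
  calc s * |∑ i ∈ Finset.range k, (|c i x| / r i - |c i y| / r i)|
      ≤ s * ∑ i ∈ Finset.range k, |(|c i x| / r i - |c i y| / r i)| := by
        gcongr; exact Finset.abs_sum_le_sum_abs _ _
    _ = ∑ i ∈ Finset.range k, s * |(|c i x| / r i - |c i y| / r i)| := Finset.mul_sum _ _ _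
    _ ≤ ∑ i ∈ Finset.range k, q * (2 * ‖x - y‖) := by
        refine Finset.sum_le_sum fun i hi => ?_
        have hri := hr i
        have h1 : |c i x - c i y| ≤ 2 * ‖x - y‖ := by
          simpa using h.abs_coord_le (x - y) i
        rw [← sub_div, abs_div, abs_of_pos hri, mul_div_left_comm, mul_comm]
        have hsq := hs i (Finset.mem_range.1 hi)
        have hs' : 0 ≤ s / r i := by positivity
        exact mul_le_mul hsq ((abs_abs_sub_abs_le _ _).trans h1) (abs_nonneg _) (hs'.trans hsq)
    _ = 2 * k * q * ‖x - y‖ := by simp; ring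

theorem IsMonotoneBasis.norm_clampCoord_sub_le (h : IsMonotoneBasis e c) (hr : ∀ n, 0 < r n)
    (k : ℕ) (q : ℝ) (hq : ∀ i < k, r k / r i ≤ q) (x y : X) :
    ‖clampCoord e c r k x - clampCoord e c r k y‖ ≤ (1 + 2 * k * q) * ‖x - y‖ := by
  set s := r k * max 0 (1 - coordGauge c r k x) with hs
  set s' := r k * max 0 (1 - coordGauge c r k y) with hs'
  have hrk := hr k
  have hss : |s - s'| ≤ 2 * k * q * ‖x - y‖ := by
    refine le_trans ?_ (h.abs_coordGauge_sub_le hr q hq hrk.le x y)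
    rw [hs, hs', ← mul_sub, abs_mul, abs_of_pos hrk]
    refine mul_le_mul_of_nonneg_left ?_ hrk.le
    rw [max_comm 0, max_comm 0]
    refine (abs_max_sub_max_le_abs _ _ _).trans_eq ?_
    rw [sub_sub_sub_cancel_left, abs_sub_comm]
  obtain ⟨θ, h0, h1, hθ⟩ := exists_clamp_sub_eq (s := s) (c k x) (c k y)
  set P : ℕ → X := fun n => ∑ i ∈ Finset.range n, c i (x - y) • e i with hP
  have hPle : ∀ n, ‖P n‖ ≤ ‖x - y‖ := h.norm_sum_le (x - y)
  have hPk : P k = ∑ i ∈ Finset.range k, c i x • e i - ∑ i ∈ Finset.range k, c i y • e i := by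
    simp [hP, sub_smul]
  have hdecomp : clampCoord e c r k x - clampCoord e c r k y =
      ((1 - θ) • P k + θ • P (k + 1)) + (clamp s (c k y) - clamp s' (c k y)) • e k := by
    have hsucc : P (k + 1) = P k + (c k x - c k y) • e k := by
      simp [hP, Finset.sum_range_succ]
    have hcl : clamp s (c k x) = θ * (c k x - c k y) + clamp s (c k y) := by linarith
    rw [hsucc, clampCoord, clampCoord, ← hs, ← hs', hcl, hPk]
    module
  rw [hdecomp]
  have hconv : ‖(1 - θ) • P k + θ • P (k + 1)‖ ≤ ‖x - y‖ := by
    refine (norm_add_le _ _).trans ?_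
    rw [norm_smul, norm_smul, Real.norm_of_nonneg h0, Real.norm_of_nonneg (sub_nonneg.2 h1)]
    nlinarith [hPle k, hPle (k + 1)]
  have herr : ‖(clamp s (c k y) - clamp s' (c k y)) • e k‖ ≤ |s - s'| := by
    rw [norm_smul, h.norm_eq_one, mul_one, Real.norm_eq_abs]
    exact abs_clamp_sub_clamp_le _ _ _
  have := norm_add_le ((1 - θ) • P k + θ • P (k + 1))
    ((clamp s (c k y) - clamp s' (c k y)) • e k)
  linarith

theorem clampCoord_of_mem (hr : ∀ n, 0 < r n) (k : ℕ) {x : X} (hx : x ∈ gaugeBall c r) :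
    clampCoord e c r k x = ∑ i ∈ Finset.range (k + 1), c i x • e i := by
  have h1 := hx (k + 1)
  have hrk := hr k
  rw [coordGauge, Finset.sum_range_succ, ← coordGauge] at h1
  rw [clampCoord, clamp_eq_self, Finset.sum_range_succ]
  have h2 : |c k x| / r k ≤ max 0 (1 - coordGauge c r k x) := le_max_of_le_right (by linarith)
  rw [div_le_iff₀ hrk] at h2
  linarith

theorem IsMonotoneBasis.norm_sub_sum_le (h : IsMonotoneBasis e c) (hr : ∀ n, 0 < r n)
    (hanti : Antitone r) (k : ℕ) {x : X} (hx : x ∈ gaugeBall c r) :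
    ‖x - ∑ i ∈ Finset.range k, c i x • e i‖ ≤ r k * (1 - coordGauge c r k x) := by
  refine le_of_tendsto ((h.tendsto x).sub_const _).norm ?_
  filter_upwards [eventually_ge_atTop k] with n hn
  have hg : coordGauge c r n x - coordGauge c r k x = ∑ i ∈ Finset.Ico k n, |c i x| / r i := by
    rw [coordGauge, coordGauge, Finset.sum_Ico_eq_sub _ hn]
  rw [← Finset.sum_Ico_eq_sub _ hn]
  calc ‖∑ i ∈ Finset.Ico k n, c i x • e i‖ ≤ ∑ i ∈ Finset.Ico k n, ‖c i x • e i‖ :=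
        _root_.norm_sum_le _ _
    _ ≤ ∑ i ∈ Finset.Ico k n, r k * (|c i x| / r i) := by
        refine Finset.sum_le_sum fun i hi => ?_
        rw [norm_smul, h.norm_eq_one, mul_one, Real.norm_eq_abs, mul_div_left_comm]
        refine le_mul_of_one_le_right (abs_nonneg _) ?_
        rw [one_le_div (hr i)]
        exact hanti (Finset.mem_Ico.1 hi).1
    _ = r k * (coordGauge c r n x - coordGauge c r k x) := by rw [hg, Finset.mul_sum]
    _ ≤ r k * (1 - coordGauge c r k x) := by
        have := hr k
        have := hx n
        gcongr

/-- The union of the ball and the span of the first `n` basis vectors. -/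
def ballUnionSpan (c : ℕ → X →L[ℝ] ℝ) (r : ℕ → ℝ) (n : ℕ) : Set X :=
  gaugeBall c r ∪ {x | ∀ i, n ≤ i → c i x = 0}

theorem ballUnionSpan_mono : Monotone (ballUnionSpan c r) := fun _ _ hmn =>
  Set.union_subset_union_right _ fun _ hx i hi => hx i (hmn.trans hi)

theorem coordGauge_of_span {n m : ℕ} (hnm : n ≤ m) {x : X} (hx : ∀ i, n ≤ i → c i x = 0) :
    coordGauge c r m x = coordGauge c r n x := by
  refine (Finset.sum_subset (Finset.range_subset_range.2 hnm) fun i _ hi => ?_).symm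
  simp [hx i (by simpa using hi)]

theorem mem_gaugeBall_of_span (hr : ∀ n, 0 < r n) {n : ℕ} {x : X}
    (hx : ∀ i, n ≤ i → c i x = 0) (hg : coordGauge c r n x ≤ 1) : x ∈ gaugeBall c r := fun m =>
  (coordGauge_mono hr x (le_max_right n m)).trans
    ((coordGauge_of_span (le_max_left n m) hx).trans_le hg)

theorem IsMonotoneBasis.sum_eq_of_span (h : IsMonotoneBasis e c) {n : ℕ} {x : X}
    (hx : ∀ i, n ≤ i → c i x = 0) : ∑ i ∈ Finset.range n, c i x • e i = x := by
  refine tendsto_nhds_unique (tendsto_const_nhds.congr' ?_) (h.tendsto x)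
  filter_upwards [eventually_ge_atTop n] with m hm
  refine Finset.sum_subset (Finset.range_subset_range.2 hm) fun i _ hi => ?_
  simp [hx i (by simpa using hi)]

open scoped Classical in
/-- One step of the retraction: the identity on the ball, `clampCoord` elsewhere. -/
noncomputable def retractStep (e : ℕ → X) (c : ℕ → X →L[ℝ] ℝ) (r : ℕ → ℝ) (k : ℕ) (x : X) : X :=
  if x ∈ gaugeBall c r then x else clampCoord e c r k x

theorem IsMonotoneBasis.retractStep_of_mem (h : IsMonotoneBasis e c) (hr : ∀ n, 0 < r n)
    {k : ℕ} {x : X} (hx : x ∈ ballUnionSpan c r k) : retractStep e c r k x = x := by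
  unfold retractStep
  split_ifs with hxK
  · rfl
  · have hx := hx.resolve_left hxK
    rw [clampCoord, hx k le_rfl, clamp_eq_self, zero_smul, add_zero, h.sum_eq_of_span hx]
    have := hr k
    rw [abs_zero]
    positivity

theorem IsMonotoneBasis.retractStep_mem (h : IsMonotoneBasis e c) (hr : ∀ n, 0 < r n)
    (k : ℕ) (x : X) : retractStep e c r k x ∈ ballUnionSpan c r k := by
  unfold retractStep
  split_ifs with hxK
  · exact Or.inl hxK
  have hrk := hr k
  set s := r k * max 0 (1 - coordGauge c r k x) with hs
  have hcoord : ∀ i, c i (clampCoord e c r k x) =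
      if i < k then c i x else if i = k then clamp s (c k x) else 0 := by
    intro i
    rw [clampCoord, map_add, h.coord_sum, map_smul, h.coord_apply, smul_eq_mul]
    grind
  have hgk : coordGauge c r k (clampCoord e c r k x) = coordGauge c r k x :=
    Finset.sum_congr rfl fun i hi => by rw [hcoord, if_pos (Finset.mem_range.1 hi)]
  have hclamp : |clamp s (c k x)| ≤ s := abs_clamp_le (by positivity)
  rcases le_total 1 (coordGauge c r k x) with hg | hg
  · right
    have hs0 : s = 0 := by rw [hs, max_eq_left (by linarith), mul_zero]
    have h0 : clamp s (c k x) = 0 := by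
      rw [hs0] at hclamp ⊢
      exact abs_nonpos_iff.1 hclamp
    intro i hi
    rw [hcoord, if_neg (by omega), h0, ite_self]
  · left
    refine mem_gaugeBall_of_span hr (n := k + 1) (fun i hi => ?_) ?_
    · rw [hcoord, if_neg (by omega), if_neg (by omega)]
    · rw [coordGauge, Finset.sum_range_succ, ← coordGauge, hgk, hcoord, if_neg (lt_irrefl k),
        if_pos rfl]
      have : |clamp s (c k x)| / r k ≤ 1 - coordGauge c r k x := by
        rw [div_le_iff₀ hrk]
        rw [hs, max_eq_right (by linarith)] at hclamp ⊢
        linarith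
      linarith

theorem IsMonotoneBasis.norm_retractStep_sub_le (h : IsMonotoneBasis e c) (hr : ∀ n, 0 < r n)
    (hanti : Antitone r) (q : ℕ → ℝ) (hq0 : ∀ n, 0 ≤ q n) (hq : ∀ n, r (n + 1) / r n ≤ q (n + 1))
    (k : ℕ) {x y : X}
    (hx : x ∈ ballUnionSpan c r (k + 1)) (hy : y ∈ ballUnionSpan c r (k + 1)) :
    ‖retractStep e c r k x - retractStep e c r k y‖ ≤
      (1 + (2 * k * q k + 2 * (k + 1) * q (k + 1))) * ‖x - y‖ := by
  have hratio : ∀ n, ∀ i < n, r n / r i ≤ q n := by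
    rintro (_ | n) i hi
    · omega
    · exact (div_le_div_of_nonneg_left (hr _).le (hr _) (hanti (Nat.le_of_lt_succ hi))).trans (hq n)
  have hA : 0 ≤ 2 * k * q k := by have := hq0 k; positivity
  have hB : 0 ≤ 2 * (k + 1) * q (k + 1) := by have := hq0 (k + 1); positivity
  have hstep := h.norm_clampCoord_sub_le hr k (q k) (hratio k)
  have hmixed : ∀ {x y : X}, x ∉ gaugeBall c r → x ∈ ballUnionSpan c r (k + 1) →
      y ∈ gaugeBall c r → ‖clampCoord e c r k x - y‖ ≤
        (1 + (2 * k * q k + 2 * (k + 1) * q (k + 1))) * ‖x - y‖ := by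
    intro x y hxK hx hyK
    have hx := hx.resolve_left hxK
    have hgx : 1 < coordGauge c r (k + 1) x :=
      not_le.1 fun hle => hxK (mem_gaugeBall_of_span hr hx hle)
    have h1 := hstep x y
    have h2 := h.norm_sub_sum_le hr hanti (k + 1) hyK
    rw [← clampCoord_of_mem hr k hyK, norm_sub_rev] at h2
    have h3 := h.abs_coordGauge_sub_le hr (q (k + 1)) (hratio (k + 1)) (hr (k + 1)).le x y
    have h4 : r (k + 1) * (1 - coordGauge c r (k + 1) y) ≤
        r (k + 1) * |coordGauge c r (k + 1) x - coordGauge c r (k + 1) y| := by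
      have := hr (k + 1)
      gcongr
      exact le_trans (by linarith) (le_abs_self _)
    have h5 := norm_sub_le_norm_sub_add_norm_sub (clampCoord e c r k x) (clampCoord e c r k y) y
    push_cast at h3
    linarith
  unfold retractStep
  split_ifs with hxK hyK hyK
  · exact le_mul_of_one_le_left (norm_nonneg _) (by linarith)
  · rw [norm_sub_rev, norm_sub_rev x]
    exact hmixed hyK hy hxK
  · exact hmixed hxK hx hyK
  · refine (hstep x y).trans ?_
    gcongr
    linarith

/-- The composition `retractStep 0 ∘ ⋯ ∘ retractStep (n - 1)`. -/
noncomputable def finRetract (e : ℕ → X) (c : ℕ → X →L[ℝ] ℝ) (r : ℕ → ℝ) : ℕ → X → X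
  | 0 => id
  | n + 1 => finRetract e c r n ∘ retractStep e c r n

theorem IsMonotoneBasis.finRetract_mem (h : IsMonotoneBasis e c) (hr : ∀ n, 0 < r n) (n : ℕ)
    {x : X} (hx : x ∈ ballUnionSpan c r n) : finRetract e c r n x ∈ gaugeBall c r := by
  induction n generalizing x with
  | zero =>
    rcases hx with hx | hx
    · exact hx
    · exact mem_gaugeBall_of_span hr hx (by simp [coordGauge])
  | succ n ih => exact ih (h.retractStep_mem hr n x)

theorem IsMonotoneBasis.finRetract_of_le (h : IsMonotoneBasis e c) (hr : ∀ n, 0 < r n)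
    {n m : ℕ} (hnm : n ≤ m) {x : X} (hx : x ∈ ballUnionSpan c r n) :
    finRetract e c r m x = finRetract e c r n x := by
  induction m, hnm using Nat.le_induction with
  | base => rfl
  | succ m hm ih =>
    rw [← ih]
    exact congrArg (finRetract e c r m) (h.retractStep_of_mem hr (ballUnionSpan_mono hm hx))

theorem IsMonotoneBasis.norm_finRetract_sub_le (h : IsMonotoneBasis e c) (hr : ∀ n, 0 < r n)
    (hanti : Antitone r) (q : ℕ → ℝ) (hq0 : ∀ n, 0 ≤ q n) (hq : ∀ n, r (n + 1) / r n ≤ q (n + 1))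
    (n : ℕ) {x y : X} (hx : x ∈ ballUnionSpan c r n) (hy : y ∈ ballUnionSpan c r n) :
    ‖finRetract e c r n x - finRetract e c r n y‖ ≤
      Real.exp (∑ k ∈ Finset.range n, (2 * k * q k + 2 * (k + 1) * q (k + 1))) * ‖x - y‖ := by
  induction n generalizing x y with
  | zero => simp [finRetract]
  | succ n ih =>
    refine (ih (h.retractStep_mem hr n x) (h.retractStep_mem hr n y)).trans ?_
    rw [Finset.sum_range_succ, Real.exp_add, mul_assoc]
    gcongr
    refine (h.norm_retractStep_sub_le hr hanti q hq0 hq n hx hy).trans ?_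
    gcongr
    linarith [Real.add_one_le_exp (2 * n * q n + 2 * (n + 1) * q (n + 1))]

theorem IsMonotoneBasis.exists_lipschitz_retract [CompleteSpace X] (h : IsMonotoneBasis e c)
    (hr : ∀ n, 0 < r n) (hanti : Antitone r) (q : ℕ → ℝ) (hq0 : ∀ n, 0 ≤ q n)
    (hq : ∀ n, r (n + 1) / r n ≤ q (n + 1)) (L : ℝ)
    (hL : ∀ n, Real.exp (∑ k ∈ Finset.range n, (2 * k * q k + 2 * (k + 1) * q (k + 1))) ≤ L) :
    ∃ R : X → X, (∀ x, R x ∈ gaugeBall c r) ∧ (∀ x ∈ gaugeBall c r, R x = x) ∧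
      ∀ x y, ‖R x - R y‖ ≤ L * ‖x - y‖ := by
  set P : ℕ → X → X := fun n x => ∑ i ∈ Finset.range n, c i x • e i with hP
  have hPcoord : ∀ n x i, c i (P n x) = if i < n then c i x else 0 :=
    fun n x i => h.coord_sum (fun i => c i x) n i
  have hPmem : ∀ n x, P n x ∈ ballUnionSpan c r n := fun n x =>
    Or.inr fun i hi => by rw [hPcoord, if_neg (by omega)]
  have hlip : ∀ n, ∀ x ∈ ballUnionSpan c r n, ∀ y ∈ ballUnionSpan c r n,
      ‖finRetract e c r n x - finRetract e c r n y‖ ≤ L * ‖x - y‖ := fun n x hx y hy =>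
    (h.norm_finRetract_sub_le hr hanti q hq0 hq n hx hy).trans (by gcongr; exact hL n)
  have hdist : ∀ x m n, dist (finRetract e c r m (P m x)) (finRetract e c r n (P n x)) ≤
      L * dist (P m x) (P n x) := by
    intro x m n
    rw [← h.finRetract_of_le hr (le_max_left m n) (hPmem m x),
      ← h.finRetract_of_le hr (le_max_right m n) (hPmem n x), dist_eq_norm, dist_eq_norm]
    exact hlip _ _ (ballUnionSpan_mono (le_max_left m n) (hPmem m x)) _
      (ballUnionSpan_mono (le_max_right m n) (hPmem n x))
  have hLpos : 0 < L := (Real.exp_pos _).trans_le (hL 0)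
  have hcauchy : ∀ x, CauchySeq fun n => finRetract e c r n (P n x) := fun x => by
    rw [Metric.cauchySeq_iff]
    intro ε hε
    obtain ⟨N, hN⟩ := Metric.cauchySeq_iff.1 (h.tendsto x).cauchySeq (ε / L) (by positivity)
    refine ⟨N, fun m hm n hn => (hdist x m n).trans_lt ?_⟩
    have := hN m hm n hn
    rwa [lt_div_iff₀' hLpos] at this
  choose R hR using fun x => cauchySeq_tendsto_of_complete (hcauchy x)
  refine ⟨R, fun x => ?_, fun x hx => ?_, fun x y => ?_⟩
  · exact isClosed_gaugeBall.mem_of_tendsto (hR x)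
      (Eventually.of_forall fun n => h.finRetract_mem hr n (hPmem n x))
  · have hPK : ∀ n, P n x ∈ gaugeBall c r := fun n => by
      refine mem_gaugeBall_of_span hr (n := n)
        (fun i hi => by rw [hPcoord, if_neg (by omega)]) (le_of_eq_of_le ?_ (hx n))
      exact Finset.sum_congr rfl fun i hi => by rw [hPcoord, if_pos (Finset.mem_range.1 hi)]
    refine tendsto_nhds_unique (hR x) ((h.tendsto x).congr fun n => ?_)
    exact (h.finRetract_of_le hr (Nat.zero_le n) (Or.inl (hPK n))).symm
  · refine le_of_tendsto_of_tendsto' ((hR x).sub (hR y)).norm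
      (((h.tendsto x).sub (h.tendsto y)).norm.const_mul L) fun n => ?_
    exact hlip n _ (hPmem n x) _ (hPmem n y)

theorem sum_error_le {η : ℝ} (hη : 0 ≤ η) (n : ℕ) :
    ∑ k ∈ Finset.range n, (2 * (k : ℝ) * (η / (8 * (k + 1) * 2 ^ k)) +
      2 * ((k : ℝ) + 1) * (η / (8 * (((k + 1 : ℕ) : ℝ) + 1) * 2 ^ (k + 1)))) ≤ η := by
  have hterm : ∀ k : ℕ, 2 * (k : ℝ) * (η / (8 * (k + 1) * 2 ^ k)) ≤ η / 4 * (1 / 2) ^ k := by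
    intro k
    rw [← mul_div_assoc, div_le_iff₀ (by positivity)]
    have : η / 4 * (1 / 2) ^ k * (8 * (k + 1) * 2 ^ k) = 2 * η * (k + 1) := by
      rw [one_div, inv_pow]; field_simp; ring
    rw [this]
    nlinarith
  calc _ ≤ ∑ k ∈ Finset.range n, η / 2 * (1 / 2 : ℝ) ^ k := by
        refine Finset.sum_le_sum fun k _ => ?_
        have h1 := hterm k
        have h2 := hterm (k + 1)
        rw [pow_succ (1 / 2 : ℝ)] at h2
        have h3 : 0 ≤ η / 4 * (1 / 2) ^ k := by positivity
        push_cast at h2 ⊢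
        linarith
    _ = η / 2 * ∑ k ∈ Finset.range n, (1 / 2 : ℝ) ^ k := (Finset.mul_sum _ _ _).symm
    _ ≤ η / 2 * 2 := by gcongr; exact sum_geometric_two_le n
    _ = η := by ring

end MonotoneBasis


open Filter Metric

/-- For every `δ > 0` there is a sequence `(q n)` of positive reals such that
for every real Banach space `X` with a normalized monotone Schauder basis `(e n)` and every
decreasing sequence `(r n)` of positive reals with `r n / r (n-1) ≤ q n` (n ≥ 1, 0-indexed),
the set `K = closed convex hull of ⋃ k, r k • B_{span (e k)}` is a `(1+δ)`-Lipschitz retract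
of `X`. -/
theorem lipschitz_retract_of_monotone_basis (δ : ℝ) (hδ : 0 < δ) :
    ∃ q : ℕ → ℝ, (∀ n, 0 < q n) ∧
      ∀ (X : Type) [NormedAddCommGroup X] [NormedSpace ℝ X] [CompleteSpace X]
        (e : ℕ → X),
        (∀ n, ‖e n‖ = 1) →
        (∀ x : X, ∃! a : ℕ → ℝ,
          Tendsto (fun n => ∑ i ∈ Finset.range n, a i • e i) atTop (nhds x)) →
        (∀ (x : X) (a : ℕ → ℝ),
          Tendsto (fun n => ∑ i ∈ Finset.range n, a i • e i) atTop (nhds x) →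
          ∀ n, ‖∑ i ∈ Finset.range n, a i • e i‖ ≤ ‖x‖) →
        ∀ r : ℕ → ℝ, (∀ n, 0 < r n) → (∀ n, r (n + 1) ≤ r n) →
          (∀ n, 1 ≤ n → r n / r (n - 1) ≤ q n) →
          ∃ R : X → X,
            (∀ x, R x ∈ closure (convexHull ℝ
              (⋃ k : ℕ, {x : X | ∃ t : ℝ, x = t • e k ∧ |t| ≤ r k}))) ∧
            (∀ k ∈ closure (convexHull ℝ
              (⋃ k : ℕ, {x : X | ∃ t : ℝ, x = t • e k ∧ |t| ≤ r k})), R k = k) ∧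
            ∀ x y : X, ‖R x - R y‖ ≤ (1 + δ) * ‖x - y‖ := by
  have hη : 0 < Real.log (1 + δ) := Real.log_pos (by linarith)
  refine ⟨fun n => Real.log (1 + δ) / (8 * (n + 1) * 2 ^ n), fun n => by positivity, ?_⟩
  intro X _ _ _ e he hex hmono r hr hdec hq
  obtain ⟨c, h⟩ := exists_isMonotoneBasis e he hex hmono
  rw [h.closure_convexHull_eq hr]
  refine h.exists_lipschitz_retract hr (antitone_nat_of_succ_le hdec)
    (fun n => Real.log (1 + δ) / (8 * (n + 1) * 2 ^ n))
    (fun n => by positivity) (fun n => hq (n + 1) (by omega)) (1 + δ) fun n => ?_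
  rw [← Real.le_log_iff_exp_le (by linarith)]
  exact sum_error_le hη.le n
end

section
/- For every n ∈ ℕ and every ε ∈ (0,1), if (E, ‖·‖) is an n-dimensional real normed space and N = ⌊(1 + 2/ε)^n⌋, then there exists a linear map T : E → ℓ∞^N such that ‖T x‖_∞ ≤ ‖x‖ ≤ ‖T x‖_∞/(1 − ε) for every x ∈ E. -/
open MeasureTheory Metric Module Function in
/-- An `ε`-separated finite subset of the unit ball of a finite-dimensional real normed space has
at most `(1 + 2 / ε) ^ finrank ℝ E` points. -/
theorem card_le_of_separated_of_norm_le_one {E : Type*} [NormedAddCommGroup E] [NormedSpace ℝ E]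
    [FiniteDimensional ℝ E] {ε : ℝ} (hε : 0 < ε) (s : Finset E) (hs : ∀ c ∈ s, ‖c‖ ≤ 1)
    (h : (s : Set E).Pairwise fun c d ↦ ε ≤ dist c d) :
    (s.card : ℝ) ≤ (1 + 2 / ε) ^ finrank ℝ E := by
  borelize E
  let μ : Measure E := Measure.addHaar
  have hδ : 0 < ε / 2 := by positivity
  have hρ : 0 < 1 + ε / 2 := by positivity
  have hdisj : (s : Set E).Pairwise (Disjoint on fun c ↦ ball c (ε / 2)) := fun c hc d hd hcd ↦
    ball_disjoint_ball (by linarith [h hc hd hcd])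
  have hsub : ⋃ c ∈ s, ball c (ε / 2) ⊆ ball (0 : E) (1 + ε / 2) :=
    Set.iUnion₂_subset fun c hc ↦ ball_subset_ball' (by
      rw [dist_zero_right]
      linarith [hs c hc])
  have hvol : (s.card : ENNReal) * ENNReal.ofReal ((ε / 2) ^ finrank ℝ E) * μ (ball 0 1) ≤
      ENNReal.ofReal ((1 + ε / 2) ^ finrank ℝ E) * μ (ball 0 1) :=
    calc
      _ = μ (⋃ c ∈ s, ball c (ε / 2)) := by
        rw [measure_biUnion_finset hdisj fun c _ ↦ measurableSet_ball]
        simp only [μ.addHaar_ball_of_pos _ hδ, Finset.sum_const, nsmul_eq_mul, mul_assoc]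
      _ ≤ μ (ball (0 : E) (1 + ε / 2)) := measure_mono hsub
      _ = _ := μ.addHaar_ball_of_pos _ hρ
  have hcard := ENNReal.toReal_le_of_le_ofReal (pow_nonneg hρ.le _)
    ((ENNReal.mul_le_mul_iff_left (measure_ball_pos μ _ zero_lt_one).ne'
      measure_ball_lt_top.ne).1 hvol)
  rw [ENNReal.toReal_mul, ENNReal.toReal_natCast,
    ENNReal.toReal_ofReal (by positivity)] at hcard
  have hratio : 1 + 2 / ε = (1 + ε / 2) / (ε / 2) := by
    field_simp
    ring
  rwa [hratio, div_pow, le_div_iff₀ (by positivity)]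

open Metric Module in
/-- The unit sphere of a finite-dimensional real normed space has an `ε`-net with at most
`(1 + 2 / ε) ^ finrank ℝ E` points. -/
theorem exists_finset_net_unit_sphere (E : Type*) [NormedAddCommGroup E] [NormedSpace ℝ E]
    [FiniteDimensional ℝ E] {ε : ℝ} (hε : 0 < ε) :
    ∃ s : Finset E, (s.card : ℝ) ≤ (1 + 2 / ε) ^ finrank ℝ E ∧ (∀ c ∈ s, ‖c‖ = 1) ∧
      ∀ x : E, ‖x‖ = 1 → ∃ c ∈ s, dist x c < ε := by
  classical
  by_contra! hnet
  have hlarge (k : ℕ) : ∃ s : Finset E, s.card = k ∧ (∀ c ∈ s, ‖c‖ = 1) ∧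
      (s : Set E).Pairwise fun c d ↦ ε ≤ dist c d := by
    induction k with
    | zero => exact ⟨∅, by simp⟩
    | succ k ih =>
      obtain ⟨s, hk, hs, hsep⟩ := ih
      obtain ⟨x, hx, hxs⟩ :=
        hnet s (card_le_of_separated_of_norm_le_one hε s (fun c hc ↦ (hs c hc).le) hsep) hs
      have hxmem : x ∉ s := fun hmem ↦ hε.not_ge (by simpa using hxs x hmem)
      refine ⟨insert x s, by rw [Finset.card_insert_of_notMem hxmem, hk], by simpa [hx] using hs, ?_⟩
      rw [Finset.coe_insert]
      exact hsep.insert fun c hc _ ↦ ⟨hxs c hc, dist_comm x c ▸ hxs c hc⟩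
  obtain ⟨s, hk, hs, hsep⟩ := hlarge (⌊(1 + 2 / ε) ^ finrank ℝ E⌋₊ + 1)
  have hcard := Nat.le_floor
    (card_le_of_separated_of_norm_le_one hε s (fun c hc ↦ (hs c hc).le) hsep)
  omega

/-- For every `n ∈ ℕ` and `ε ∈ (0,1)`, every `n`-dimensional real normed
space `E` admits a linear map `T : E → ℓ∞^N`, with `N = ⌊(1 + 2/ε)^n⌋`, such that
`‖T x‖_∞ ≤ ‖x‖ ≤ ‖T x‖_∞ / (1 - ε)` for every `x ∈ E`. -/
theorem almost_isometric_embedding_into_linfty_fin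
    (n : ℕ) (ε : ℝ) (hε : ε ∈ Set.Ioo (0 : ℝ) 1)
    (E : Type*) [NormedAddCommGroup E] [NormedSpace ℝ E]
    [FiniteDimensional ℝ E] (hdim : Module.finrank ℝ E = n) :
    ∃ T : E →ₗ[ℝ] (Fin (Nat.floor ((1 + 2 / ε) ^ n)) → ℝ),
      ∀ x : E, ‖T x‖ ≤ ‖x‖ ∧ ‖x‖ ≤ ‖T x‖ / (1 - ε) := by
  subst hdim
  obtain ⟨hε0, hε1⟩ := hε
  obtain ⟨s, hcard, hs, hnet⟩ := exists_finset_net_unit_sphere E hε0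
  choose g hg hgx using exists_dual_vector'' ℝ (E := E)
  let T : E →ₗ[ℝ] (Fin ⌊(1 + 2 / ε) ^ Module.finrank ℝ E⌋₊ → ℝ) :=
    LinearMap.pi fun i ↦ (g (s.toList.getD i 0)).toLinearMap
  have hle (x : E) : ‖T x‖ ≤ ‖x‖ :=
    (pi_norm_le_iff_of_nonneg (norm_nonneg x)).2 fun i ↦
      ContinuousLinearMap.le_of_opNorm_le_of_le _ (hg _) le_rfl |>.trans_eq (one_mul _)
  have hge_unit (x : E) (hx : ‖x‖ = 1) : 1 - ε ≤ ‖T x‖ := by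
    obtain ⟨c, hc, hxc⟩ := hnet x hx
    obtain ⟨i, hi, rfl⟩ := List.getElem_of_mem (Finset.mem_toList.2 hc)
    have hiN : i < ⌊(1 + 2 / ε) ^ Module.finrank ℝ E⌋₊ :=
      (hi.trans_eq s.length_toList).trans_le (Nat.le_floor hcard)
    set c := s.toList[i]
    have hTi : T x ⟨i, hiN⟩ = g c x := by
      simp [T, c, List.getElem?_eq_getElem hi]
    have hdiff : g c (c - x) ≤ dist x c := by
      rw [dist_comm, dist_eq_norm]
      exact (le_abs_self _).trans
        ((g c).le_of_opNorm_le_of_le (hg c) le_rfl |>.trans_eq (one_mul _))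
    have hgc : g c c = 1 := (hgx c).trans (by simp [hs c hc])
    rw [map_sub, hgc] at hdiff
    calc
      1 - ε ≤ g c x := by linarith
      _ ≤ ‖T x ⟨i, hiN⟩‖ := hTi ▸ le_abs_self _
      _ ≤ ‖T x‖ := norm_le_pi_norm _ _
  refine ⟨T, fun x ↦ ⟨hle x, ?_⟩⟩
  rw [le_div_iff₀ (by linarith)]
  obtain rfl | hx := eq_or_ne x 0
  · simp
  · have hunit := hge_unit (‖x‖⁻¹ • x) (norm_smul_inv_norm hx)
    rwa [map_smul, norm_smul, norm_inv, norm_norm, inv_mul_eq_div,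
      le_div_iff₀ (norm_pos_iff.2 hx), mul_comm] at hunit
end

section
/- Let X be a real Banach space, let ε ∈ (0,1), and let E ⊆ X be a linear subspace of dimension n. Then there exists a linear subspace G with E ⊆ G ⊆ X and dim G ≤ (1 + 2/ε)^n such that λ(E, X) ≤ (2/(1 − ε))·λ(E, G). -/
open Filter Metric

/-- The projection constant of a subspace `E` in the whole space `X`:
`λ(E, X) = inf{‖P‖ : P : X → E bounded linear, P e = e for e ∈ E}`. -/
noncomputable def projConst {X : Type*} [NormedAddCommGroup X] [NormedSpace ℝ X]
    (E : Submodule ℝ X) : ℝ :=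
  sInf {c : ℝ | ∃ P : X →L[ℝ] X, (∀ x, P x ∈ E) ∧ (∀ e ∈ E, P e = e) ∧ ‖P‖ = c}

/-- The relative projection constant `λ(E, G)` of a subspace `E` of `X` inside a subspace
`G` of `X`: the infimum of norms of bounded linear maps `P : G → E` fixing `E` pointwise. -/
noncomputable def relProjConst {X : Type*} [NormedAddCommGroup X] [NormedSpace ℝ X]
    (E G : Submodule ℝ X) : ℝ :=
  sInf {c : ℝ | ∃ P : G →L[ℝ] X, (∀ y : G, P y ∈ E) ∧ (∀ y : G, (y : X) ∈ E → P y = y) ∧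
    ‖P‖ = c}

open MeasureTheory Module in
/-- Volume bound for the cardinality of an `ε`-separated subset of the closed unit ball. -/
theorem card_le_of_separated_unit_ball {V : Type*} [NormedAddCommGroup V] [NormedSpace ℝ V]
    [FiniteDimensional ℝ V] {ε : ℝ} (hε : 0 < ε) (s : Finset V) (hs : ∀ c ∈ s, ‖c‖ ≤ 1)
    (h : ∀ c ∈ s, ∀ d ∈ s, c ≠ d → ε ≤ ‖c - d‖) :
    (s.card : ℝ) ≤ (1 + 2 / ε) ^ finrank ℝ V := by
  borelize V
  let μ : Measure V := Measure.addHaar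
  have hδ : 0 < ε / 2 := by positivity
  have hρ : 0 < 1 + ε / 2 := by positivity
  have disj : Set.Pairwise (s : Set V) (Function.onFun Disjoint fun c => ball c (ε / 2)) := by
    intro c hc d hd hcd
    apply ball_disjoint_ball
    rw [dist_eq_norm, add_halves]
    exact h c hc d hd hcd
  have sub : (⋃ c ∈ s, ball c (ε / 2)) ⊆ ball (0 : V) (1 + ε / 2) := by
    refine Set.iUnion₂_subset fun x hx => ball_subset_ball' ?_
    rw [dist_zero_right]
    linarith [hs x hx]
  have vol : (s.card : ENNReal) * ENNReal.ofReal ((ε / 2) ^ finrank ℝ V) * μ (ball 0 1) ≤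
      ENNReal.ofReal ((1 + ε / 2) ^ finrank ℝ V) * μ (ball 0 1) :=
    calc
      _ = μ (⋃ c ∈ s, ball c (ε / 2)) := by
        rw [measure_biUnion_finset disj fun c _ => measurableSet_ball]
        simp only [μ.addHaar_ball_of_pos _ hδ, Finset.sum_const, nsmul_eq_mul, mul_assoc]
      _ ≤ μ (ball (0 : V) (1 + ε / 2)) := measure_mono sub
      _ = _ := by simp only [μ.addHaar_ball_of_pos _ hρ]
  have vol' := (ENNReal.mul_le_mul_iff_left (measure_ball_pos μ _ zero_lt_one).ne'
    measure_ball_lt_top.ne).1 vol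
  have key := ENNReal.toReal_le_of_le_ofReal (pow_nonneg hρ.le _) vol'
  rw [ENNReal.toReal_mul, ENNReal.toReal_natCast, ENNReal.toReal_ofReal (by positivity)] at key
  have e : 1 + 2 / ε = (1 + ε / 2) / (ε / 2) := by field_simp; ring
  rw [e, div_pow, le_div_iff₀ (by positivity)]
  exact key

open Module in
/-- The closed unit ball of a `d`-dimensional normed space contains an `ε`-net with at most
`(1 + 2/ε)^d` elements. -/
theorem exists_finset_net_unit_ball {V : Type*} [NormedAddCommGroup V] [NormedSpace ℝ V]
    [FiniteDimensional ℝ V] {ε : ℝ} (hε : 0 < ε) :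
    ∃ s : Finset V, (s.card : ℝ) ≤ (1 + 2 / ε) ^ finrank ℝ V ∧ (∀ c ∈ s, ‖c‖ ≤ 1) ∧
      ∀ v : V, ‖v‖ ≤ 1 → ∃ c ∈ s, ‖v - c‖ ≤ ε := by
  classical
  let T : Set ℕ := {k | ∃ s : Finset V, (∀ c ∈ s, ‖c‖ ≤ 1) ∧
    (∀ c ∈ s, ∀ d ∈ s, c ≠ d → ε ≤ ‖c - d‖) ∧ s.card = k}
  have hne : T.Nonempty := ⟨0, ∅, by simp⟩
  have hbdd : BddAbove T := by
    refine ⟨⌈(1 + 2 / ε) ^ finrank ℝ V⌉₊, ?_⟩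
    rintro _ ⟨s, h1, h2, rfl⟩
    exact_mod_cast (card_le_of_separated_unit_ball hε s h1 h2).trans (Nat.le_ceil _)
  obtain ⟨s, h1, h2, hcard⟩ := Nat.sSup_mem hne hbdd
  refine ⟨s, card_le_of_separated_unit_ball hε s h1 h2, h1, fun v hv => ?_⟩
  by_contra! hfar
  have hvs : v ∉ s := fun hvs => by
    have := hfar v hvs
    simp at this
    linarith
  have hmem : s.card + 1 ∈ T := by
    refine ⟨insert v s, ?_, ?_, Finset.card_insert_of_notMem hvs⟩
    · simpa using ⟨hv, h1⟩
    · intro c hc d hd hcd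
      rcases Finset.mem_insert.1 hc with rfl | hc <;> rcases Finset.mem_insert.1 hd with rfl | hd
      · exact absurd rfl hcd
      · exact (hfar d hd).le
      · rw [norm_sub_rev]
        exact (hfar _ ‹_›).le
      · exact h2 c hc d hd hcd
  have := le_csSup hbdd hmem
  omega

open Module in
/-- A `d`-dimensional normed space is `(1-ε)`-normed by at most `(1 + 2/ε)^d` functionals. -/
theorem exists_finset_norming {V : Type*} [NormedAddCommGroup V] [NormedSpace ℝ V]
    [FiniteDimensional ℝ V] {ε : ℝ} (hε : 0 < ε) :
    ∃ s : Finset (StrongDual ℝ V), (s.card : ℝ) ≤ (1 + 2 / ε) ^ finrank ℝ V ∧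
      (∀ f ∈ s, ‖f‖ ≤ 1) ∧ ∀ v : V, ∃ f ∈ s, (1 - ε) * ‖v‖ ≤ f v := by
  obtain ⟨s, hcard, hs, hnet⟩ := exists_finset_net_unit_ball (V := StrongDual ℝ V) hε
  have hdim : finrank ℝ (StrongDual ℝ V) = finrank ℝ V := by
    rw [← (LinearMap.toContinuousLinearMap (𝕜 := ℝ) (E := V) (F' := ℝ)).finrank_eq]
    exact Subspace.dual_finrank_eq
  refine ⟨s, hdim ▸ hcard, hs, fun v => ?_⟩
  obtain ⟨g, hg, hgv⟩ := exists_dual_vector'' ℝ v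
  obtain ⟨f, hf, hgf⟩ := hnet g hg
  refine ⟨f, hf, ?_⟩
  have h1 : (g - f) v ≤ ε * ‖v‖ :=
    (le_abs_self _).trans ((g - f).le_of_opNorm_le hgf v)
  have h2 : g v = ‖v‖ := by simpa using hgv
  rw [sub_apply, h2] at h1
  linarith

/-- A norming family of functionals separates points. -/
theorem pi_injective_of_norming {V ι : Type*} [NormedAddCommGroup V] [NormedSpace ℝ V]
    {f : ι → StrongDual ℝ V} {κ : ℝ} (hκ : 0 < κ) (hnorm : ∀ v : V, ∃ i, κ * ‖v‖ ≤ f i v) :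
    Function.Injective (LinearMap.pi fun i => (f i).toLinearMap) := by
  rw [← LinearMap.ker_eq_bot, LinearMap.ker_eq_bot']
  intro v hv
  obtain ⟨i, hi⟩ := hnorm v
  have : f i v = 0 := congrFun hv i
  rw [this] at hi
  exact norm_le_zero_iff.1 (nonpos_of_mul_nonpos_right hi hκ)

section Tensor

variable {X : Type*} [NormedAddCommGroup X] [NormedSpace ℝ X] {E : Submodule ℝ X}
  {ι : Type*} [Fintype ι]

/-- The tuples `x` for which the tensor `∑ i, f i ⊗ x i` maps `E` into itself. -/
def tensorDomain (f : ι → StrongDual ℝ E) : Submodule ℝ (ι → X) where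
  carrier := {x | ∀ e : E, ∑ i, f i e • x i ∈ E}
  add_mem' {x y} hx hy e := by
    simpa [smul_add, Finset.sum_add_distrib] using E.add_mem (hx e) (hy e)
  zero_mem' e := by simp
  smul_mem' c x hx e := by
    simpa [Finset.smul_sum, smul_comm c] using E.smul_mem c (hx e)

theorem mem_tensorDomain {f : ι → StrongDual ℝ E} {x : ι → X} :
    x ∈ tensorDomain f ↔ ∀ e : E, ∑ i, f i e • x i ∈ E := Iff.rfl

/-- If the trace functional is bounded by `c` on the tensors mapping `E` into itself, and the
functionals `f i` are `κ`-norming for `E`, then `λ(E, X) ≤ c / κ`. -/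
theorem projConst_le_of_trace_le [FiniteDimensional ℝ E] {f : ι → StrongDual ℝ E} {κ c : ℝ}
    (hκ : 0 < κ) (hc : 0 ≤ c) (hnorm : ∀ v : E, ∃ i, κ * ‖v‖ ≤ f i v)
    (R : X →L[ℝ] E) (hR : ∀ e : E, R e = e)
    (h : ∀ x ∈ tensorDomain f, ∑ i, f i (R (x i)) ≤ c * ∑ i, ‖x i‖) :
    projConst E ≤ c / κ := by
  classical
  let τ : (ι → X) →ₗ[ℝ] ℝ :=
    ∑ i, (f i).toLinearMap ∘ₗ R.toLinearMap ∘ₗ LinearMap.proj i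
  have hτ (x) : τ x = ∑ i, f i (R (x i)) := by simp [τ]
  obtain ⟨g, hgτ, hgle⟩ := exists_extension_of_le_sublinear
    ⟨tensorDomain f, τ.domRestrict (tensorDomain f)⟩ (fun x => c * ∑ i, ‖x i‖)
    (fun r hr x => by
      simp only [Pi.smul_apply, norm_smul, Real.norm_of_nonneg hr.le, ← Finset.mul_sum]
      ring)
    (fun x y => by
      rw [← mul_add, ← Finset.sum_add_distrib]
      exact mul_le_mul_of_nonneg_left (Finset.sum_le_sum fun i _ => norm_add_le _ _) hc)
    (fun x => by simpa [hτ] using h x x.2)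
  replace hgτ : ∀ x ∈ tensorDomain f, g x = ∑ i, f i (R (x i)) := fun x hx => by
    rw [← hτ]
    exact hgτ ⟨x, hx⟩
  obtain ⟨L, hL⟩ := LinearMap.exists_leftInverse_of_injective _
    (LinearMap.ker_eq_bot.2 (pi_injective_of_norming hκ hnorm))
  replace hL (v : E) : L (fun i => f i v) = v := LinearMap.congr_fun hL v
  let φ (i : ι) : X →ₗ[ℝ] ℝ := g ∘ₗ LinearMap.single ℝ (fun _ => X) i
  have hg (x : ι → X) : g x = ∑ i, φ i (x i) := by
    conv_lhs => rw [← Finset.univ_sum_single x, map_sum]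
    rfl
  have hφ (i : ι) (x : X) : φ i x ≤ c * ‖x‖ := by
    refine (hgle (Pi.single i x)).trans_eq ?_
    rw [Finset.sum_eq_single i] <;> simp +contextual
  have hφE (i : ι) (e : E) : φ i e = f i e := by
    have := hgτ (Pi.single i (e : X)) fun v => by
      rw [Finset.sum_eq_single i]
      · simpa using E.smul_mem _ e.2
      · simp +contextual
      · simp
    refine this.trans ?_
    rw [Finset.sum_eq_single i]
    · simp [hR]
    · simp +contextual
    · simp
  let P : X →ₗ[ℝ] E := L ∘ₗ LinearMap.pi φ
  have hfL (j : ι) (a : ι → ℝ) : f j (L a) = ∑ i, a i * f j (L (Pi.single i 1)) := by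
    conv_lhs => rw [pi_eq_sum_univ' a]
    simp only [map_sum, map_smul, smul_eq_mul]
  have hfP (j : ι) (x : X) : f j (P x) = φ j x := by
    have hrel (e : E) :
        ∑ i, f i e * (f j (L (Pi.single i 1)) - (Pi.single j 1 : ι → ℝ) i) = 0 := by
      simp_rw [mul_sub, Finset.sum_sub_distrib]
      rw [← hfL j (fun i => f i e), hL]
      simp [Pi.single_apply]
    have hx := hgτ (fun i => (f j (L (Pi.single i 1)) - (Pi.single j 1 : ι → ℝ) i) • x)
      fun e => by simp [smul_smul, ← Finset.sum_smul, hrel]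
    have h0 : ∑ i, f i (R ((f j (L (Pi.single i 1)) - (Pi.single j 1 : ι → ℝ) i) • x)) = 0 := by
      rw [← hrel (R x)]
      refine Finset.sum_congr rfl fun i _ => ?_
      rw [map_smul, map_smul, smul_eq_mul, mul_comm]
    rw [h0, hg] at hx
    simp only [map_smul, smul_eq_mul, sub_mul, Finset.sum_sub_distrib] at hx
    rw [show P x = L (fun i => φ i x) from rfl, hfL]
    simp only [mul_comm (φ _ x)]
    simpa [Pi.single_apply, sub_eq_zero] using hx
  have hPE (e : E) : P e = e := by
    change L (fun i => φ i e) = e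
    simp only [hφE]
    exact hL e
  have hPn (x : X) : ‖E.subtype (P x)‖ ≤ c / κ * ‖x‖ := by
    obtain ⟨i, hi⟩ := hnorm (P x)
    rw [hfP] at hi
    rw [div_mul_eq_mul_div, le_div_iff₀ hκ, mul_comm]
    exact hi.trans (hφ i x)
  let P' : X →L[ℝ] X := (E.subtype ∘ₗ P).mkContinuous (c / κ) hPn
  refine le_trans (b := ‖P'‖) (csInf_le ⟨0, ?_⟩ ⟨P', fun x => (P x).2, fun e he => ?_, rfl⟩)
    (LinearMap.mkContinuous_norm_le _ (by positivity) _)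
  · rintro _ ⟨Q, -, -, rfl⟩
    exact norm_nonneg Q
  · exact congrArg Subtype.val (hPE ⟨e, he⟩)

/-- The trace of a tensor in `tensorDomain f` can be computed with any projection defined on
a subspace containing its components. -/
theorem trace_eq_of_projection [FiniteDimensional ℝ E] {f : ι → StrongDual ℝ E} {x : ι → X}
    (hx : x ∈ tensorDomain f) {G : Submodule ℝ X} (hxG : ∀ i, x i ∈ G)
    (Q : G →ₗ[ℝ] E) (hQ : ∀ (y : G) (hy : (y : X) ∈ E), Q y = ⟨y, hy⟩)
    (R : X →ₗ[ℝ] E) (hR : ∀ e : E, R e = e) :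
    ∑ i, f i (R (x i)) = ∑ i, f i (Q ⟨x i, hxG i⟩) := by
  have key : ∑ i, (f i).toLinearMap.smulRight (R (x i)) =
      ∑ i, (f i).toLinearMap.smulRight (Q ⟨x i, hxG i⟩) := by
    ext1 e
    have hsum : ((∑ i, f i e • (⟨x i, hxG i⟩ : G) : G) : X) = ∑ i, f i e • x i := by simp
    have h1 := hQ (∑ i, f i e • (⟨x i, hxG i⟩ : G)) (hsum ▸ hx e)
    have h2 := hR ⟨_, hx e⟩
    simp only [map_sum, map_smul] at h1 h2
    simp only [LinearMap.sum_apply, LinearMap.smulRight_apply, ContinuousLinearMap.coe_coe]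
    rw [h1, h2]
    exact Subtype.ext hsum.symm
  have := congrArg (LinearMap.trace ℝ E) key
  simpa [map_sum, LinearMap.trace_smulRight] using this

/-- A tensor with large trace can be perturbed so that its components span a space containing
`E`. -/
theorem exists_le_span_of_trace_gt [FiniteDimensional ℝ E] {f : ι → StrongDual ℝ E} {c : ℝ}
    (hf : Function.Injective (LinearMap.pi fun i => (f i).toLinearMap))
    (R : X →L[ℝ] E) (hR : ∀ e : E, R e = e) {x : ι → X} (hx : x ∈ tensorDomain f)
    (hgt : c * ∑ i, ‖x i‖ < ∑ i, f i (R (x i))) :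
    ∃ y ∈ tensorDomain f, c * ∑ i, ‖y i‖ < ∑ i, f i (R (y i)) ∧
      E ≤ Submodule.span ℝ (Set.range y) := by
  classical
  obtain ⟨L, hL⟩ := LinearMap.exists_leftInverse_of_injective _ (LinearMap.ker_eq_bot.2 hf)
  replace hL (v : E) : L (fun i => f i v) = v := LinearMap.congr_fun hL v
  let b (i : ι) : E := L (Pi.single i 1)
  have hb (v : E) : ∑ i, f i v • b i = v := by
    conv_rhs => rw [← hL v, pi_eq_sum_univ' (fun i => f i v)]
    simp only [map_sum, map_smul]
    rfl
  let y (η : ℝ) (i : ι) : X := x i + η • (b i : X)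
  let u : E →ₗ[ℝ] E := ∑ i, (f i).toLinearMap.smulRight (R (x i))
  have hu (e : E) : (u e : X) = ∑ i, f i e • x i := by
    have h2 := congrArg Subtype.val (hR ⟨_, hx e⟩)
    simp only [map_sum, map_smul] at h2
    rw [← h2]
    simp [u]
  have hy (η : ℝ) (e : E) : ∑ i, f i e • y η i = ((u e + η • e : E) : X) := by
    have h3 := congrArg Subtype.val (hb e)
    simp only [AddSubmonoidClass.coe_finsetSum, Submodule.coe_smul] at h3
    simp only [y, smul_add, Finset.sum_add_distrib, Submodule.coe_add, Submodule.coe_smul, hu]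
    congr 1
    conv_rhs => rw [← h3, Finset.smul_sum]
    exact Finset.sum_congr rfl fun i _ => smul_comm _ _ _
  have hopen : ∀ᶠ η in nhds (0 : ℝ), c * ∑ i, ‖y η i‖ < ∑ i, f i (R (y η i)) := by
    have h1 : Continuous fun η => c * ∑ i, ‖y η i‖ := by fun_prop
    have h2 : Continuous fun η => ∑ i, f i (R (y η i)) := by fun_prop
    refine (isOpen_lt h1 h2).mem_nhds ?_
    simpa [y] using hgt
  have hinf : {η : ℝ | c * ∑ i, ‖y η i‖ < ∑ i, f i (R (y η i))}.Infinite :=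
    infinite_of_mem_nhds 0 hopen
  have hfin : {η : ℝ | Module.End.HasEigenvalue (-u) η}.Finite := Module.End.finite_hasEigenvalue (-u)
  obtain ⟨η, hη, hev⟩ := (hinf.sdiff hfin).nonempty
  refine ⟨y η, fun e => hy η e ▸ Submodule.coe_mem _, hη, fun e he => ?_⟩
  have hinj : Function.Injective (u + η • LinearMap.id : E →ₗ[ℝ] E) := by
    rw [← LinearMap.ker_eq_bot, LinearMap.ker_eq_bot']
    intro v hv
    by_contra hv0
    refine hev (Module.End.hasEigenvalue_of_hasEigenvector
      (Module.End.hasEigenvector_iff.2 ⟨Module.End.mem_eigenspace_iff.2 ?_, hv0⟩))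
    rw [LinearMap.neg_apply, neg_eq_iff_add_eq_zero]
    exact hv
  obtain ⟨v, hv⟩ := LinearMap.surjective_of_injective hinj ⟨e, he⟩
  have hv' : ((u v + η • v : E) : X) = e := congrArg Subtype.val hv
  rw [← hv', ← hy η v]
  exact Submodule.sum_mem _ fun i _ =>
    Submodule.smul_mem _ _ (Submodule.subset_span (Set.mem_range_self i))

/-- Contractive functionals and a tensor with components in `G` bound `λ(E, G)` from below. -/
theorem le_relProjConst_of_trace_gt [FiniteDimensional ℝ E] {f : ι → StrongDual ℝ E} {c : ℝ}
    (hf : ∀ i, ‖f i‖ ≤ 1) (R : X →L[ℝ] E) (hR : ∀ e : E, R e = e) {x : ι → X}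
    (hx : x ∈ tensorDomain f) (hgt : c * ∑ i, ‖x i‖ < ∑ i, f i (R (x i)))
    {G : Submodule ℝ X} (hxG : ∀ i, x i ∈ G) :
    c ≤ relProjConst E G := by
  refine le_csInf ⟨_, E.subtypeL ∘L R ∘L G.subtypeL, fun y => (R y).2,
    fun y hy => congrArg Subtype.val (hR ⟨y, hy⟩), rfl⟩ ?_
  rintro _ ⟨Q, hQE, hQ, rfl⟩
  by_contra! hlt
  refine hgt.not_ge ?_
  let Q' : G →ₗ[ℝ] E := Q.toLinearMap.codRestrict E hQE
  have htr := trace_eq_of_projection hx hxG Q' (fun y hy => Subtype.ext (hQ y hy)) R.toLinearMap hR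
  refine (htr.trans_le (Finset.sum_le_sum (g := fun i => ‖Q‖ * ‖x i‖) fun i _ => ?_)).trans ?_
  · calc f i (Q' ⟨x i, hxG i⟩) ≤ ‖f i (Q' ⟨x i, hxG i⟩)‖ := le_abs_self _
      _ ≤ 1 * ‖Q' ⟨x i, hxG i⟩‖ := (f i).le_of_opNorm_le (hf i) _
      _ ≤ ‖Q‖ * ‖x i‖ := (one_mul _).trans_le (Q.le_opNorm ⟨x i, hxG i⟩)
  · rw [← Finset.mul_sum]
    exact mul_le_mul_of_nonneg_right hlt.le (Finset.sum_nonneg fun i _ => norm_nonneg _)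

end Tensor

/-- **Milman's lemma.** Let `X` be a real Banach space, `ε ∈ (0,1)` and `E ⊆ X`
a subspace of dimension `n`. Then there is a subspace `G` with `E ⊆ G ⊆ X`,
`dim G ≤ (1 + 2/ε)^n`, and `λ(E, X) ≤ (2/(1-ε)) · λ(E, G)`. -/
theorem projection_constant_witnessed_by_finite_dimensional_subspace
    {X : Type*} [NormedAddCommGroup X] [NormedSpace ℝ X] [CompleteSpace X]
    (ε : ℝ) (hε : ε ∈ Set.Ioo (0 : ℝ) 1)
    (E : Submodule ℝ X) [FiniteDimensional ℝ E] (n : ℕ) (hn : Module.finrank ℝ E = n) :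
    ∃ G : Submodule ℝ X, E ≤ G ∧ FiniteDimensional ℝ G ∧
      (Module.finrank ℝ G : ℝ) ≤ (1 + 2 / ε) ^ n ∧
      projConst E ≤ 2 / (1 - ε) * relProjConst E G := by
  obtain ⟨hε0, hε1⟩ := hε
  have hκ : 0 < 1 - ε := by linarith
  obtain ⟨s, hcard, hs, hnorm⟩ := exists_finset_norming (V := E) hε0
  obtain ⟨R, hR⟩ := Submodule.ClosedComplemented.of_finiteDimensional E
  let f : s → StrongDual ℝ E := Subtype.val
  have hnorm' (v : E) : ∃ i, (1 - ε) * ‖v‖ ≤ f i v := by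
    obtain ⟨g, hg, hgv⟩ := hnorm v
    exact ⟨⟨g, hg⟩, hgv⟩
  have hf := pi_injective_of_norming hκ hnorm'
  rcases le_or_gt (projConst E) 0 with h0 | h0
  · refine ⟨E, le_rfl, inferInstance, ?_, h0.trans (mul_nonneg (by positivity) ?_)⟩
    · rw [← hn]
      refine le_trans ?_ hcard
      have := LinearMap.finrank_le_finrank_of_injective hf
      rw [Module.finrank_fintype_fun_eq_card, Fintype.card_coe] at this
      exact_mod_cast this
    · apply Real.sInf_nonneg
      rintro _ ⟨Q, -, -, rfl⟩
      exact norm_nonneg Q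
  set c := (1 - ε) / 2 * projConst E with hc
  obtain ⟨x, hx, hgt⟩ : ∃ x ∈ tensorDomain f, c * ∑ i, ‖x i‖ < ∑ i, f i (R (x i)) := by
    by_contra! hle
    have := projConst_le_of_trace_le hκ (by positivity) hnorm' R hR hle
    rw [hc, le_div_iff₀ hκ] at this
    nlinarith
  obtain ⟨y, hy, hgt', hEy⟩ := exists_le_span_of_trace_gt hf R hR hx hgt
  refine ⟨Submodule.span ℝ (Set.range y), hEy, FiniteDimensional.span_of_finite ℝ (Set.finite_range y), ?_, ?_⟩
  · rw [← hn]
    refine le_trans ?_ hcard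
    exact_mod_cast (finrank_range_le_card y).trans_eq (Fintype.card_coe s)
  · have := le_relProjConst_of_trace_gt (fun i : s => hs i.1 i.2) R hR hy hgt'
      (fun i => Submodule.subset_span (Set.mem_range_self i))
    rw [div_mul_eq_mul_div, le_div_iff₀ hκ]
    linarith
end

section
/- Let E be a real Banach space and Y ⊆ E a finite-dimensional linear subspace. If there is a Lipschitz retraction φ from the closed unit ball B_E of E onto the closed unit ball B_Y of Y (i.e. φ : B_E → B_Y is Lipschitz with constant L and φ(y) = y for all y ∈ B_Y), then there exists a bounded linear projection P : E → Y with P(y) = y for all y ∈ Y and ‖P‖ ≤ 2L. -/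
open Metric

open Filter Topology

/-- A linear operator on `V`-valued functions that fixes constants and does not increase the
supremum norm. -/
structure IsAveraging {G V : Type*} [NormedAddCommGroup V] [NormedSpace ℝ V]
    (T : Module.End ℝ (G → V)) : Prop where
  map_const : ∀ v : V, T (fun _ ↦ v) = fun _ ↦ v
  norm_le : ∀ (f : G → V) (C : ℝ), (∀ x, ‖f x‖ ≤ C) → ∀ x, ‖T f x‖ ≤ C

namespace IsAveraging

variable {G V : Type*} [NormedAddCommGroup V] [NormedSpace ℝ V]

theorem one : IsAveraging (1 : Module.End ℝ (G → V)) :=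
  ⟨fun _ ↦ rfl, fun _ _ h ↦ h⟩

theorem mul {S T : Module.End ℝ (G → V)} (hS : IsAveraging S) (hT : IsAveraging T) :
    IsAveraging (S * T) :=
  ⟨fun v ↦ by rw [Module.End.mul_apply, hT.map_const, hS.map_const],
    fun f C h ↦ hS.norm_le _ C (hT.norm_le f C h)⟩

theorem pow {T : Module.End ℝ (G → V)} (hT : IsAveraging T) (k : ℕ) : IsAveraging (T ^ k) := by
  induction k with
  | zero => exact one
  | succ k ih => exact pow_succ T k ▸ ih.mul hT

theorem mean {T : ℕ → Module.End ℝ (G → V)} (hT : ∀ k, IsAveraging (T k)) (n : ℕ) :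
    IsAveraging (((n : ℝ) + 1)⁻¹ • ∑ k ∈ Finset.range (n + 1), T k) := by
  have hn : (0 : ℝ) < (n : ℝ) + 1 := by positivity
  refine ⟨fun v ↦ ?_, fun f C h x ↦ ?_⟩
  · ext x
    simp only [LinearMap.smul_apply, LinearMap.sum_apply, (hT _).map_const, Pi.smul_apply,
      Finset.sum_const, Finset.card_range]
    rw [← Nat.cast_smul_eq_nsmul ℝ, smul_smul]
    push_cast
    rw [inv_mul_cancel₀ hn.ne', one_smul]
  · simp only [LinearMap.smul_apply, LinearMap.sum_apply, Pi.smul_apply, Finset.sum_apply]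
    rw [norm_smul, norm_inv, Real.norm_of_nonneg hn.le, inv_mul_le_iff₀ hn]
    refine (norm_sum_le_of_le _ fun k _ ↦ (hT k).norm_le f C h x).trans ?_
    simp

end IsAveraging

/-- Translation of functions on an additive commutative group, as a representation. -/
def translation (G V : Type*) [AddCommGroup G] [NormedAddCommGroup V] [NormedSpace ℝ V] :
    Multiplicative G →* Module.End ℝ (G → V) where
  toFun a := LinearMap.funLeft ℝ V fun x ↦ x + a.toAdd
  map_one' := by ext f x; simp [LinearMap.funLeft]
  map_mul' a b := by
    ext f x
    simp [LinearMap.funLeft, add_assoc]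

theorem isAveraging_translation {G V : Type*} [AddCommGroup G] [NormedAddCommGroup V]
    [NormedSpace ℝ V] (a : Multiplicative G) : IsAveraging (translation G V a) :=
  ⟨fun _ ↦ rfl, fun _ _ h x ↦ h (x + a.toAdd)⟩

/-- The commutativity of `G` enters through the commutativity of its group algebra. -/
theorem exists_isAveraging_almost_invariant {G V : Type*} [AddCommGroup G]
    [NormedAddCommGroup V] [NormedSpace ℝ V] (S : Finset (Multiplicative G)) (n : ℕ) :
    ∃ T : Module.End ℝ (G → V), IsAveraging T ∧
      ∀ a ∈ S, ∀ (f : G → V) (C : ℝ), (∀ x, ‖f x‖ ≤ C) →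
        ∀ x, ‖T (translation G V a f) x - T f x‖ ≤ ((n : ℝ) + 1)⁻¹ * (C + C) := by
  classical
  let ρ := MonoidAlgebra.lift ℝ (Module.End ℝ (G → V)) (Multiplicative G) (translation G V)
  let m : Multiplicative G → MonoidAlgebra ℝ (Multiplicative G) := fun a ↦
    ((n : ℝ) + 1)⁻¹ • ∑ k ∈ Finset.range (n + 1), MonoidAlgebra.of ℝ (Multiplicative G) a ^ k
  have hρ (a) : ρ (MonoidAlgebra.of ℝ (Multiplicative G) a) = translation G V a := by
    simp [ρ]
  have hprod (R : Finset (Multiplicative G)) : IsAveraging (ρ (∏ a ∈ R, m a)) := by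
    refine Finset.prod_induction m (fun b ↦ IsAveraging (ρ b)) (fun b c hb hc ↦ ?_) ?_ fun a _ ↦ ?_
    · rw [map_mul]; exact hb.mul hc
    · rw [map_one]; exact IsAveraging.one
    · simp only [m, map_smul, map_sum, map_pow, hρ]
      exact IsAveraging.mean (fun k ↦ (isAveraging_translation a).pow k) n
  refine ⟨ρ (∏ a ∈ S, m a), hprod S, fun a ha f C hf x ↦ ?_⟩
  have key : ρ (∏ b ∈ S, m b) * (translation G V a - 1) =
      ((n : ℝ) + 1)⁻¹ • (ρ (∏ b ∈ S.erase a, m b) * (translation G V a ^ (n + 1) - 1)) := by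
    rw [← hρ a, ← map_one ρ, ← map_sub, ← map_mul, ← map_pow, ← map_sub, ← map_mul, ← map_smul,
      ← Finset.prod_erase_mul S m ha, mul_assoc, smul_mul_assoc, geom_sum_mul, mul_smul_comm]
  have hx := congrFun (LinearMap.congr_fun key f) x
  simp only [Module.End.mul_apply, LinearMap.sub_apply, Module.End.one_apply, map_sub,
    Pi.sub_apply, LinearMap.smul_apply, Pi.smul_apply] at hx
  rw [hx, norm_smul, norm_inv, Real.norm_of_nonneg (by positivity)]
  gcongr
  exact norm_sub_le_of_le
    ((hprod _).norm_le _ C (((isAveraging_translation a).pow _).norm_le f C hf) x)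
    ((hprod _).norm_le f C hf x)

theorem Ultrafilter.exists_tendsto_of_eventually_norm_le {ι V : Type*} [NormedAddCommGroup V]
    [ProperSpace V] (l : Ultrafilter ι) {u : ι → V} {C : ℝ} (h : ∀ᶠ i in l, ‖u i‖ ≤ C) :
    ∃ v, Tendsto u l (𝓝 v) := by
  obtain ⟨v, -, hv⟩ := (isCompact_closedBall (0 : V) C).ultrafilter_le_nhds (l.map u)
    (le_principal_iff.2 (h.mono fun i hi ↦ mem_closedBall_zero_iff.2 hi))
  exact ⟨v, hv⟩

/-- Additive commutative groups are amenable, for means of functions with values in a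
finite-dimensional space. -/
theorem exists_invariant_mean (G V : Type*) [AddCommGroup G] [NormedAddCommGroup V]
    [NormedSpace ℝ V] [FiniteDimensional ℝ V] :
    ∃ M : (G → V) → V, (∀ v, M (fun _ ↦ v) = v) ∧
      (∀ f C, (∀ x, ‖f x‖ ≤ C) → ‖M f‖ ≤ C) ∧
      (∀ f g C D, (∀ x, ‖f x‖ ≤ C) → (∀ x, ‖g x‖ ≤ D) → M (fun x ↦ f x - g x) = M f - M g) ∧
      ∀ f C, (∀ x, ‖f x‖ ≤ C) → ∀ a, M (fun x ↦ f (x + a)) = M f := by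
  classical
  have : ProperSpace V := FiniteDimensional.proper ℝ V
  choose T hT hinv using fun i : Finset (Multiplicative G) × ℕ ↦
    exists_isAveraging_almost_invariant (V := V) i.1 i.2
  let l : Ultrafilter (Finset (Multiplicative G) × ℕ) := Ultrafilter.of atTop
  have hl : l.toFilter ≤ atTop := Ultrafilter.of_le atTop
  let M : (G → V) → V := fun f ↦ limUnder l.toFilter fun i ↦ T i f 0
  have lim (f : G → V) (C : ℝ) (hf : ∀ x, ‖f x‖ ≤ C) :
      Tendsto (fun i ↦ T i f 0) l (𝓝 (M f)) :=
    tendsto_nhds_limUnder (l.exists_tendsto_of_eventually_norm_le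
      (Eventually.of_forall fun i ↦ (hT i).norm_le f C hf 0))
  refine ⟨M, fun v ↦ ?_, fun f C hf ↦ ?_, fun f g C D hf hg ↦ ?_, fun f C hf a ↦ ?_⟩
  · simp only [M, (hT _).map_const]
    exact tendsto_const_nhds.limUnder_eq
  · exact le_of_tendsto (lim f C hf).norm
      (Eventually.of_forall fun i ↦ (hT i).norm_le f C hf 0)
  · refine Tendsto.limUnder_eq (((lim f C hf).sub (lim g D hg)).congr fun i ↦ ?_)
    exact (congrFun (map_sub (T i) f g) 0).symm
  · have hz : Tendsto (fun i ↦ T i (fun x ↦ f (x + a)) 0 - T i f 0) l (𝓝 0) := by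
      have h0 : Tendsto (fun i : Finset (Multiplicative G) × ℕ ↦ ((i.2 : ℝ) + 1)⁻¹ * (C + C))
          atTop (𝓝 0) := by
        rw [← prod_atTop_atTop_eq]
        simpa [one_div] using ((tendsto_one_div_add_atTop_nhds_zero_nat (𝕜 := ℝ)).comp
          (tendsto_snd (f := (atTop : Filter (Finset (Multiplicative G)))))).mul_const (C + C)
      refine squeeze_zero_norm' ?_ (h0.mono_left hl)
      filter_upwards [hl (mem_atTop (({Multiplicative.ofAdd a} : Finset _), 0))] with i hi
      exact hinv i _ (hi.1 (Finset.mem_singleton_self _)) f C hf 0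
    exact sub_eq_zero.1 (tendsto_nhds_unique
      ((lim _ C fun x ↦ hf (x + a)).sub (lim f C hf)) hz)

/-- Blowing up a Lipschitz map at the origin. -/
theorem LipschitzOnWith.exists_blowup {E V : Type*} [NormedAddCommGroup E] [NormedSpace ℝ E]
    [NormedAddCommGroup V] [NormedSpace ℝ V] [FiniteDimensional ℝ V] {L : NNReal} {f : E → V}
    (hf : LipschitzOnWith L f (closedBall 0 1)) (h0 : f 0 = 0) :
    ∃ Φ : E → V, LipschitzWith L Φ ∧ ∀ x v,
      (∀ t : ℝ, 0 < t → t • x ∈ closedBall (0 : E) 1 → f (t • x) = t • v) → Φ x = v := by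
  have : ProperSpace V := FiniteDimensional.proper ℝ V
  let l : Ultrafilter ℕ := hyperfilter ℕ
  let t : ℕ → ℝ := fun n ↦ 1 / ((n : ℝ) + 1)
  have ht (n) : 0 < t n := by positivity
  have hmem (x : E) : ∀ᶠ n in (l : Filter ℕ), t n • x ∈ closedBall (0 : E) 1 := by
    have : Tendsto (fun n ↦ t n • x) l (𝓝 0) := by
      simpa [t, l] using ((tendsto_one_div_add_atTop_nhds_zero_nat (𝕜 := ℝ)).smul_const x).mono_left
        Nat.hyperfilter_le_atTop
    exact this.eventually (closedBall_mem_nhds 0 one_pos)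
  let u : E → ℕ → V := fun x n ↦ (t n)⁻¹ • f (t n • x)
  have hu (x y : E) : ∀ᶠ n in (l : Filter ℕ), ‖u x n - u y n‖ ≤ L * ‖x - y‖ := by
    filter_upwards [hmem x, hmem y] with n hx hy
    have := hf.norm_sub_le hx hy
    rw [← smul_sub, norm_smul, Real.norm_of_nonneg (ht n).le] at this
    rw [← smul_sub, norm_smul, norm_inv, Real.norm_of_nonneg (ht n).le, inv_mul_le_iff₀ (ht n)]
    linarith
  have hu0 (x : E) : ∀ᶠ n in (l : Filter ℕ), ‖u x n‖ ≤ L * ‖x‖ := by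
    simpa [u, h0] using hu x 0
  choose Φ hΦ using fun x ↦ l.exists_tendsto_of_eventually_norm_le (hu0 x)
  refine ⟨Φ, LipschitzWith.of_dist_le_mul fun x y ↦ ?_, fun x v hv ↦ ?_⟩
  · rw [dist_eq_norm, dist_eq_norm]
    exact le_of_tendsto ((hΦ x).sub (hΦ y)).norm (hu x y)
  · refine tendsto_nhds_unique (hΦ x) (tendsto_const_nhds.congr' ?_)
    filter_upwards [hmem x] with n hx
    simp only [u]
    rw [hv _ (ht n) hx, smul_smul, inv_mul_cancel₀ (ht n).ne', one_smul]

/-- A Lipschitz retraction onto a finite-dimensional subspace can be averaged to a linear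
projection with the same constant. -/
theorem LipschitzWith.exists_linear_projection {E : Type*} [NormedAddCommGroup E]
    [NormedSpace ℝ E] (Y : Submodule ℝ E) [FiniteDimensional ℝ Y] {L : NNReal} {Φ : E → Y}
    (hΦ : LipschitzWith L Φ) (hfix : ∀ y : Y, Φ y = y) :
    ∃ P : E →L[ℝ] Y, (∀ y : Y, P y = y) ∧ ‖P‖ ≤ L := by
  obtain ⟨M, Mconst, Mnorm, Msub, Minv⟩ := exists_invariant_mean E Y
  obtain ⟨N, Nconst, Nnorm, Nsub, Ninv⟩ := exists_invariant_mean Y Y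
  let D : E → E → Y → Y := fun x z y ↦ Φ (x + (z + y)) - Φ (z + y)
  have hD (x z y) : ‖D x z y‖ ≤ L * ‖x‖ := by
    simpa [D] using hΦ.norm_sub_le (x + (z + y)) (z + y)
  have hND (x z) : ‖N (D x z)‖ ≤ L * ‖x‖ := Nnorm _ _ (hD x z)
  let P : E → Y := fun x ↦ M fun z ↦ N (D x z)
  have hP (x) : ‖P x‖ ≤ L * ‖x‖ := Mnorm _ _ (hND x)
  have hadd (x x') : P (x + x') = P x + P x' := by
    have h1 (z) : N (D x (z + x')) = N (D (x + x') z) - N (D x' z) := by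
      rw [← Nsub _ _ _ _ (hD (x + x') z) (hD x' z)]
      congr 1
      ext1 y
      simp only [D, sub_sub_sub_cancel_right]
      congr 2 <;> abel
    have h2 := Minv _ _ (hND x) x'
    simp only [h1] at h2
    rw [Msub _ _ _ _ (hND (x + x')) (hND x')] at h2
    exact sub_eq_iff_eq_add.1 h2
  have hPfix (y' : Y) : P y' = y' := by
    have hN (z : E) : N (D y' z) = y' := by
      let h : Y → Y := fun y ↦ Φ (z + y) - y
      have hh (y) : ‖h y‖ ≤ L * ‖z‖ := by
        have := hΦ.norm_sub_le (z + y) y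
        rwa [hfix, add_sub_cancel_right] at this
      have h1 := Nsub _ _ _ _ (hD y' z) (fun _ ↦ le_refl ‖y'‖)
      have h2 := Nsub _ _ _ _ (fun y ↦ hh (y + y')) hh
      rw [Ninv h _ hh y', sub_self] at h2
      have h3 : (fun y ↦ D y' z y - y') = fun y ↦ h (y + y') - h y := by
        ext1 y
        have : (y' : E) + (z + y) = z + (y + y' : Y) := by push_cast; abel
        simp only [D, h, this]
        abel
      rw [h3, h2, Nconst] at h1
      exact sub_eq_zero.1 h1.symm
    simp only [P, hN, Mconst]
  let A : E →+ Y := AddMonoidHom.mk' P hadd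
  refine ⟨A.toRealLinearMap (AddMonoidHomClass.continuous_of_bound A L hP), hPfix,
    ContinuousLinearMap.opNorm_le_bound _ L.2 hP⟩

/-- If `Y` is a finite-dimensional subspace of a real Banach space `E` and
there is an `L`-Lipschitz retraction `φ` from the closed unit ball `B_E` onto the closed
unit ball `B_Y` of `Y`, then there is a bounded linear projection `P : E → Y` with
`‖P‖ ≤ 2L`. -/
theorem linear_projection_of_lipschitz_ball_retraction
    {E : Type*} [NormedAddCommGroup E] [NormedSpace ℝ E] [CompleteSpace E]
    (Y : Submodule ℝ E) [FiniteDimensional ℝ Y]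
    (L : NNReal) (φ : E → E)
    (hmaps : ∀ x ∈ closedBall (0 : E) 1, φ x ∈ Y ∧ ‖φ x‖ ≤ 1)
    (hfix : ∀ y ∈ closedBall (0 : E) 1, y ∈ Y → φ y = y)
    (hlip : LipschitzOnWith L φ (closedBall (0 : E) 1)) :
    ∃ P : E →L[ℝ] E, (∀ x, P x ∈ Y) ∧ (∀ y ∈ Y, P y = y) ∧ ‖P‖ ≤ 2 * (L : ℝ) := by
  have hex (x : E) : ∃ y : Y, x ∈ closedBall (0 : E) 1 → (y : E) = φ x := by
    by_cases hx : x ∈ closedBall (0 : E) 1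
    · exact ⟨⟨φ x, (hmaps x hx).1⟩, fun _ ↦ rfl⟩
    · exact ⟨0, fun h ↦ absurd h hx⟩
  choose f hf using hex
  have hflip : LipschitzOnWith L f (closedBall 0 1) := fun x hx y hy ↦ by
    rw [Subtype.edist_eq, hf x hx, hf y hy]
    exact hlip hx hy
  have hffix (y : Y) (hy : (y : E) ∈ closedBall (0 : E) 1) : f y = y :=
    Subtype.ext ((hf _ hy).trans (hfix _ hy y.2))
  obtain ⟨Φ, hΦ, hΦfix⟩ := hflip.exists_blowup (hffix 0 (by simp))
  obtain ⟨P, hP, hPn⟩ := hΦ.exists_linear_projection Y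
    fun y ↦ hΦfix y y fun t _ ht ↦ hffix (t • y) ht
  refine ⟨Y.subtypeL ∘L P, fun x ↦ (P x).2, fun y hy ↦ congrArg Subtype.val (hP ⟨y, hy⟩), ?_⟩
  refine ContinuousLinearMap.opNorm_le_bound _ (by positivity) fun x ↦ ?_
  calc ‖P x‖ ≤ L * ‖x‖ := P.le_of_opNorm_le hPn x
    _ ≤ 2 * L * ‖x‖ := by gcongr; linarith [L.2]
end

section
/- Let n ∈ ℕ and let Y be a closed linear subspace of ℓ∞ = ℓ∞(ℕ, ℝ) which is linearly isometric to the n-dimensional Euclidean space ℓ₂^n. If ψ : ℓ∞ → Y is a Lipschitz retraction (ψ(y) = y for all y ∈ Y), then the Lipschitz constant of ψ is at least n^{1/4}/3. -/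
open Metric

noncomputable section

/-- Truncation of a real number to the interval `[-w, w]`. -/
def truncate (w u : ℝ) : ℝ := max (-w) (min u w)

lemma abs_truncate_le {w : ℝ} (hw : 0 ≤ w) (u : ℝ) : |truncate w u| ≤ w :=
  abs_le.2 ⟨le_max_left _ _, max_le (by linarith) (min_le_right _ _)⟩

lemma abs_truncate_sub_le {w : ℝ} (hw : 0 < w) (u : ℝ) :
    |truncate w u - u| ≤ u ^ 2 / (4 * w) := by
  rw [le_div_iff₀ (by positivity)]
  unfold truncate
  rcases le_total u w with h | h
  · rw [min_eq_left h]
    rcases le_total (-w) u with h' | h'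
    · rw [max_eq_right h', sub_self, abs_zero, zero_mul]
      positivity
    · rw [max_eq_left h', abs_of_nonneg (by linarith)]
      nlinarith [sq_nonneg (u + 2 * w)]
  · rw [min_eq_right h, max_eq_right (by linarith), abs_of_nonpos (by linarith)]
    nlinarith [sq_nonneg (u - 2 * w)]

/-- The sign `±1` attached to a Boolean. -/
def boolSign (b : Bool) : ℝ := if b then 1 else -1

lemma abs_boolSign (b : Bool) : |boolSign b| = 1 := by
  cases b <;> simp [boolSign]

lemma boolSign_not (b : Bool) : boolSign (!b) = -boolSign b := by
  cases b <;> simp [boolSign]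

/-- The permutation of the discrete cube which flips the `i`-th coordinate. -/
def flipCoord {n : ℕ} (i : Fin n) : Equiv.Perm (Fin n → Bool) :=
  Function.Involutive.toPerm (fun x => Function.update x i (!x i)) fun x => by simp

lemma flipCoord_apply {n : ℕ} (i : Fin n) (x : Fin n → Bool) :
    flipCoord i x = Function.update x i (!x i) := rfl

/-- The vertex of the cube `{-1, 1}ⁿ` in Euclidean space with the given signs. -/
def signVector {n : ℕ} (x : Fin n → Bool) : EuclideanSpace ℝ (Fin n) :=
  WithLp.toLp 2 fun i => boolSign (x i)

lemma signVector_apply {n : ℕ} (x : Fin n → Bool) (i : Fin n) :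
    signVector x i = boolSign (x i) := rfl

lemma inner_signVector {n : ℕ} (x : Fin n → Bool) (v : EuclideanSpace ℝ (Fin n)) :
    inner ℝ (signVector x) v = ∑ i, boolSign (x i) * v i := by
  simp [PiLp.inner_apply, signVector_apply, mul_comm]

lemma norm_signVector {n : ℕ} (x : Fin n → Bool) : ‖signVector x‖ = √n := by
  simp [EuclideanSpace.norm_eq, signVector_apply, abs_boolSign]

/-- A map from the discrete cube to Euclidean space which moves vertices by at most `A` and
whose oscillation along edges is at most `B` satisfies `2n ≤ 2√n A + n B`. -/
lemma two_mul_le_of_near_signVector {n : ℕ}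
    (G : (Fin n → Bool) → EuclideanSpace ℝ (Fin n)) {A B : ℝ}
    (hA : ∀ x, ‖G x - signVector x‖ ≤ A) (hB : ∀ x i, ‖G x - G (flipCoord i x)‖ ≤ B) :
    2 * (n : ℝ) ≤ 2 * (√n * A) + n * B := by
  have hlow (x : Fin n → Bool) : (n : ℝ) - √n * A ≤ ∑ i, boolSign (x i) * G x i := by
    have h1 : inner ℝ (signVector x) (signVector x) = (n : ℝ) := by
      rw [real_inner_self_eq_norm_sq, norm_signVector, Real.sq_sqrt n.cast_nonneg]
    have h2 := (abs_le.1 (abs_real_inner_le_norm (signVector x) (G x - signVector x))).1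
    rw [inner_sub_right, h1, norm_signVector, inner_signVector] at h2
    have h3 := mul_le_mul_of_nonneg_left (hA x) (Real.sqrt_nonneg n)
    linarith
  have hup (i : Fin n) :
      2 * ∑ x, boolSign (x i) * G x i ≤ ∑ _x : Fin n → Bool, B := by
    have hflip : ∑ x, boolSign (x i) * G x i
        = ∑ x, -(boolSign (x i) * G (flipCoord i x) i) := by
      rw [← Equiv.sum_comp (flipCoord i)]
      refine Finset.sum_congr rfl fun x _ => ?_
      rw [show flipCoord i x i = !x i by simp [flipCoord_apply], boolSign_not]
      ring
    rw [two_mul]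
    nth_rewrite 2 [hflip]
    rw [← Finset.sum_add_distrib]
    refine Finset.sum_le_sum fun x _ => ?_
    calc boolSign (x i) * G x i + -(boolSign (x i) * G (flipCoord i x) i)
        = boolSign (x i) * (G x - G (flipCoord i x)) i := by
          rw [PiLp.sub_apply]; ring
      _ ≤ |boolSign (x i) * (G x - G (flipCoord i x)) i| := le_abs_self _
      _ = ‖(G x - G (flipCoord i x)) i‖ := by
          rw [abs_mul, abs_boolSign, one_mul, Real.norm_eq_abs]
      _ ≤ B := (PiLp.norm_apply_le _ i).trans (hB x i)
  have hsum : ∑ _x : Fin n → Bool, 2 * ((n : ℝ) - √n * A)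
      ≤ ∑ _i : Fin n, ∑ _x : Fin n → Bool, B := by
    calc ∑ _x : Fin n → Bool, 2 * ((n : ℝ) - √n * A)
        ≤ ∑ x : Fin n → Bool, 2 * ∑ i, boolSign (x i) * G x i :=
          Finset.sum_le_sum fun x _ => by linarith [hlow x]
      _ = ∑ i, 2 * ∑ x : Fin n → Bool, boolSign (x i) * G x i := by
          rw [← Finset.mul_sum, Finset.sum_comm, Finset.mul_sum]
      _ ≤ _ := Finset.sum_le_sum fun i _ => hup i
  rw [Finset.sum_comm] at hsum
  simp only [Finset.sum_const, Finset.card_univ, nsmul_eq_mul, Fintype.card_fin] at hsum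
  have hpos : (0 : ℝ) < Fintype.card (Fin n → Bool) := by exact_mod_cast Fintype.card_pos
  have := le_of_mul_le_mul_left hsum hpos
  linarith

/-- The `ℓ∞` sequence of signed sums of truncations of `u k i`. -/
def truncatedSum {n : ℕ} {w : ℝ} (hw : 0 ≤ w) (u : ℕ → Fin n → ℝ) (x : Fin n → Bool) :
    lp (fun _ : ℕ => ℝ) ⊤ :=
  ⟨fun k => ∑ i, boolSign (x i) * truncate w (u k i), memℓp_infty ⟨∑ _i : Fin n, w, by
    rintro _ ⟨k, rfl⟩
    refine norm_sum_le_of_le _ fun i _ => ?_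
    rw [Real.norm_eq_abs, abs_mul, abs_boolSign, one_mul]
    exact abs_truncate_le hw _⟩⟩

lemma truncatedSum_apply {n : ℕ} {w : ℝ} (hw : 0 ≤ w) (u : ℕ → Fin n → ℝ)
    (x : Fin n → Bool) (k : ℕ) :
    truncatedSum hw u x k = ∑ i, boolSign (x i) * truncate w (u k i) := rfl

lemma norm_truncatedSum_sub_flipCoord_le {n : ℕ} {w : ℝ} (hw : 0 ≤ w) (u : ℕ → Fin n → ℝ)
    (x : Fin n → Bool) (i : Fin n) :
    ‖truncatedSum hw u x - truncatedSum hw u (flipCoord i x)‖ ≤ 2 * w := by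
  refine lp.norm_le_of_forall_le (by positivity) fun k => ?_
  have h : (truncatedSum hw u x - truncatedSum hw u (flipCoord i x)) k
      = 2 * (boolSign (x i) * truncate w (u k i)) := by
    rw [lp.coeFn_sub, Pi.sub_apply, truncatedSum_apply, truncatedSum_apply,
      ← Finset.sum_sub_distrib, Finset.sum_eq_single i]
    · rw [show flipCoord i x i = !x i by simp [flipCoord_apply], boolSign_not]
      ring
    · intro j _ hj
      rw [flipCoord_apply, Function.update_of_ne hj, sub_self]
    · simp
  rw [h, Real.norm_eq_abs, abs_mul, abs_mul, abs_boolSign, one_mul, abs_two]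
  linarith [abs_truncate_le hw (u k i)]

lemma norm_truncatedSum_sub_le {n : ℕ} {w : ℝ} (hw : 0 < w)
    (S : EuclideanSpace ℝ (Fin n) →ₗᵢ[ℝ] lp (fun _ : ℕ => ℝ) ⊤) (x : Fin n → Bool) :
    ‖truncatedSum hw.le (fun k i => S (EuclideanSpace.single i 1) k) x - S (signVector x)‖
      ≤ 1 / (4 * w) := by
  have hS (v : EuclideanSpace ℝ (Fin n)) (k : ℕ) :
      S v k = ∑ i, v i * S (EuclideanSpace.single i 1) k := by
    have hv : v = ∑ i, v i • EuclideanSpace.single i (1 : ℝ) := by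
      ext j
      simp [Finset.sum_apply, Pi.single_apply]
    conv_lhs => rw [hv]
    simp only [map_sum, map_smul, lp.coeFn_sum, lp.coeFn_smul]
    exact Finset.sum_apply k _ _
  refine lp.norm_le_of_forall_le (by positivity) fun k => ?_
  set u : Fin n → ℝ := fun i => S (EuclideanSpace.single i 1) k with hu
  have hsq : ∑ i, u i ^ 2 ≤ 1 := by
    have h1 : ‖S (WithLp.toLp 2 u) k‖ ≤ ‖WithLp.toLp 2 u‖ :=
      (lp.norm_apply_le_norm ENNReal.top_ne_zero _ k).trans_eq (S.norm_map _)
    have h2 : S (WithLp.toLp 2 u) k = ‖WithLp.toLp 2 u‖ ^ 2 := by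
      rw [hS, EuclideanSpace.real_norm_sq_eq]
      exact Finset.sum_congr rfl fun i _ => (sq (u i)).symm
    have h3 : ∑ i, u i ^ 2 = ‖WithLp.toLp 2 u‖ ^ 2 := by
      rw [EuclideanSpace.real_norm_sq_eq]
    rw [h2, Real.norm_eq_abs, abs_of_nonneg (by positivity)] at h1
    rw [h3]
    nlinarith [norm_nonneg (WithLp.toLp 2 u)]
  rw [lp.coeFn_sub, Pi.sub_apply, hS, truncatedSum_apply, ← Finset.sum_sub_distrib]
  calc ‖∑ i, (boolSign (x i) * truncate w (u i) - signVector x i * u i)‖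
      ≤ ∑ i, u i ^ 2 / (4 * w) := by
        refine norm_sum_le_of_le _ fun i _ => ?_
        rw [signVector_apply, ← mul_sub, Real.norm_eq_abs, abs_mul, abs_boolSign, one_mul]
        exact abs_truncate_sub_le hw _
    _ = (∑ i, u i ^ 2) / (4 * w) := (Finset.sum_div _ _ _).symm
    _ ≤ 1 / (4 * w) := by gcongr

end

/-- **Lindenstrauss.** If `Y` is a closed subspace of `ℓ∞ = ℓ∞(ℕ, ℝ)` which is
linearly isometric to `ℓ₂^n`, and `ψ : ℓ∞ → Y` is a Lipschitz retraction, then the Lipschitz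
constant of `ψ` is at least `n^{1/4} / 3`. -/
theorem lipschitz_retraction_onto_euclidean_subspace_of_linfty_lower_bound
    (n : ℕ) (Y : Submodule ℝ (lp (fun _ : ℕ => ℝ) ⊤))
    (hYc : IsClosed (Y : Set (lp (fun _ : ℕ => ℝ) ⊤)))
    (hiso : Nonempty (Y ≃ₗᵢ[ℝ] EuclideanSpace ℝ (Fin n)))
    (ψ : lp (fun _ : ℕ => ℝ) ⊤ → lp (fun _ : ℕ => ℝ) ⊤)
    (hψY : ∀ x, ψ x ∈ Y) (hfix : ∀ y ∈ Y, ψ y = y)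
    (L : NNReal) (hlip : LipschitzWith L ψ) :
    (n : ℝ) ^ ((1 : ℝ) / 4) / 3 ≤ (L : ℝ) := by
  obtain ⟨e⟩ := hiso
  rcases Nat.eq_zero_or_pos n with rfl | hn
  · simp
  set t : ℝ := (n : ℝ) ^ ((1 : ℝ) / 4) with ht
  have hn' : (0 : ℝ) < n := by exact_mod_cast hn
  have htpos : 0 < t := Real.rpow_pos_of_pos hn' _
  have ht4 : (n : ℝ) = t ^ 4 := by
    rw [ht, ← Real.rpow_natCast, ← Real.rpow_mul hn'.le]
    norm_num
  have hsqrt : √(n : ℝ) = t ^ 2 := by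
    rw [ht4, show t ^ 4 = (t ^ 2) ^ 2 by ring, Real.sqrt_sq (by positivity)]
  have hw : 0 < 1 / (2 * t) := by positivity
  let S : EuclideanSpace ℝ (Fin n) →ₗᵢ[ℝ] lp (fun _ : ℕ => ℝ) ⊤ :=
    Y.subtypeₗᵢ.comp e.symm.toLinearIsometry
  let T : (Fin n → Bool) → lp (fun _ : ℕ => ℝ) ⊤ :=
    truncatedSum hw.le fun k i => S (EuclideanSpace.single i 1) k
  let F : lp (fun _ : ℕ => ℝ) ⊤ → EuclideanSpace ℝ (Fin n) := fun z => e ⟨ψ z, hψY z⟩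
  have hF (z z' : lp (fun _ : ℕ => ℝ) ⊤) : ‖F z - F z'‖ ≤ L * ‖z - z'‖ := by
    rw [← map_sub, e.norm_map]
    exact hlip.norm_sub_le z z'
  have hFS (v : EuclideanSpace ℝ (Fin n)) : F (S v) = v := by
    have : (⟨ψ (S v), hψY _⟩ : Y) = e.symm v := Subtype.ext (hfix _ (e.symm v).2)
    change e ⟨ψ (S v), hψY _⟩ = v
    rw [this, e.apply_symm_apply]
  have key := two_mul_le_of_near_signVector (fun x => F (T x))
    (A := L * (1 / (4 * (1 / (2 * t))))) (B := L * (2 * (1 / (2 * t))))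
    (fun x => by
      have h := hF (T x) (S (signVector x))
      rw [hFS] at h
      exact h.trans (mul_le_mul_of_nonneg_left (norm_truncatedSum_sub_le hw S x) L.2))
    (fun x i => (hF _ _).trans
      (mul_le_mul_of_nonneg_left (norm_truncatedSum_sub_flipCoord_le hw.le _ x i) L.2))
  have hLt : t ≤ L := by
    rw [hsqrt, ht4] at key
    field_simp at key
    nlinarith
  linarith
end
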